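/- arXiv:2006.16330 — 2 statements merged into one kernel-verified Lean document; each statement's English description precedes it below -/
import Mathlib

section
/- Let 𝔊_TY = (B, Δ, S, ε) be the Tambara–Yamagami weak Hopf *-algebra attached to (G, χ, τ). Define linear maps on V := ⊕_{y∈Ω} H^y by, for g, h, k ∈ G: P^h(v^g_k) = δ_{g,0} v^0_{k+h}; P^h(v^g_m) = v^g_m; P^m(v^g_k) = δ_{g,0}·sign(τ)·Σ_{p∈G} χ(p,k) v^p_m; P^m(v^g_m) = τ^{−1}|G|^{1/2} Σ_{p∈G} χ(g,p) v^0_p; and P^h = P^m = 0 on H^m (here sign(τ) := τ|G|^{1/2} ∈ {±1}). Then a coideal of 𝔊_TY of the form I = Σ_{y∈Ω} X^y ⊗ conj(H^y), with subspaces X^y ⊆ H^y, is invariant under the right adjoint action if and only if the subspace ⊕_{y∈Ω} X^y of V satisfies ⊕_y X^y = P^h(⊕_y X^y) for every h ∈ G and ⊕_y X^y = P^m(⊕_y X^y). -/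
open scoped TensorProduct

noncomputable section

open scoped Classical

section TY

variable (G : Type) [AddCommGroup G] [Fintype G] [DecidableEq G]

/-- The index set `Ω = G ⊔ {m}` of the set of simple objects. -/
abbrev ΩIdx := G ⊕ Unit

/-- The index set `G ⊔ Ḡ` of the basis of `H^m`. -/
abbrev MIdx := G ⊕ G

/-- The basis index set of `V = ⊕_{x ∈ Ω} H^x`: `inl (g, y)` is `v^g_y` (`y ∈ Ω`),
`inr (inl k)` is `v^m_k` and `inr (inr k)` is `v^m_{k̄}`. -/
abbrev VIdx := (G × ΩIdx G) ⊕ MIdx G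

/-- The tyGrade (`∈ Ω`) of a basis vector of `V`. -/
def tyGrade : VIdx G → ΩIdx G
  | Sum.inl (g, _) => Sum.inl g
  | Sum.inr _ => Sum.inr ()

/-- `V = ⊕_{x ∈ Ω} H^x`, as coordinate functions. -/
abbrev TYV := VIdx G → ℂ

/-- Basis index set of `B = ⊕_{x ∈ Ω} H^x ⊗ conj(H^x)`: pairs of equal tyGrade;
the pair `(α, β)` of tyGrade `x` encodes `f^x_{α,β} = v^x_α ⊗ conj (v^x_β)`. -/
abbrev BIdx := {p : VIdx G × VIdx G // tyGrade G p.1 = tyGrade G p.2}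

/-- The underlying space of the Tambara–Yamagami weak Hopf `*`-algebra. -/
abbrev TYB := BIdx G → ℂ

/-- Structure constants of the multiplication `∘` on `V`:
`circC χ τ a b c` is the coefficient of the basis vector `c` in `(basis a) ∘ (basis b)`. -/
def circC (χ : G → G → ℂ) (τ : ℝ) : VIdx G → VIdx G → VIdx G → ℂ
  | Sum.inl (g, Sum.inl k), Sum.inl (h, x), r =>
      if x = Sum.inl (h + k) ∧ r = Sum.inl (g + h, Sum.inl (h + k)) then 1 else 0
  | Sum.inl (g, Sum.inr _), Sum.inl (h, x), r =>
      if x = Sum.inr () ∧ r = Sum.inl (g + h, Sum.inr ()) then 1 else 0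
  | Sum.inl (g, Sum.inl k), Sum.inr (Sum.inl k'), r =>
      if k = k' ∧ r = Sum.inr (Sum.inl (k' - g)) then 1 else 0
  | Sum.inl (_, Sum.inr _), Sum.inr (Sum.inl _), _ => 0
  | Sum.inl (_, Sum.inl _), Sum.inr (Sum.inr _), _ => 0
  | Sum.inl (g, Sum.inr _), Sum.inr (Sum.inr k'), r =>
      if r = Sum.inr (Sum.inr k') then χ g k' else 0
  | Sum.inr (Sum.inl k), Sum.inl (g, x), r =>
      if x = Sum.inr () ∧ r = Sum.inr (Sum.inl k) then χ g k else 0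
  | Sum.inr (Sum.inr k), Sum.inl (g, x), r =>
      if x = Sum.inl (g + k) ∧ r = Sum.inr (Sum.inr (g + k)) then 1 else 0
  | Sum.inr (Sum.inl h), Sum.inr (Sum.inr k), r =>
      if r = Sum.inl (k - h, Sum.inl k) then 1 else 0
  | Sum.inr (Sum.inr h), Sum.inr (Sum.inl k), r =>
      if h = k then
        (match r with
          | Sum.inl (g, Sum.inr _) => (τ : ℂ) * (χ g h)⁻¹
          | _ => 0)
      else 0
  | Sum.inr (Sum.inl _), Sum.inr (Sum.inl _), _ => 0
  | Sum.inr (Sum.inr _), Sum.inr (Sum.inr _), _ => 0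

/-- The multiplication of the Tambara–Yamagami WHA:
`f^x_{α,β} f^y_{γ,δ} = (v^x_α ∘ v^y_γ) ⊗ conj (v^x_β ∘ v^y_δ)`. -/
def mulTY (χ : G → G → ℂ) (τ : ℝ) (f f' : TYB G) : TYB G := fun r =>
  ∑ p : BIdx G, ∑ q : BIdx G,
    f p * f' q * circC G χ τ p.1.1 q.1.1 r.1.1 * star (circC G χ τ p.1.2 q.1.2 r.1.2)

/-- The unit `1 = Σ_{z,w ∈ Ω} f^0_{z,w}` of the Tambara–Yamagami WHA. -/
def oneTY : TYB G := fun r =>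
  match r.1.1 with
  | Sum.inl (g, _) => if g = 0 then 1 else 0
  | Sum.inr _ => 0

/-- Structure constants of the coproduct: `Δ(f^x_{α,β}) = Σ_γ f^x_{α,γ} ⊗ f^x_{γ,β}`. -/
def Δc : BIdx G → BIdx G → BIdx G → ℂ := fun p q r =>
  if q.1.1 = p.1.1 ∧ r.1.2 = p.1.2 ∧ q.1.2 = r.1.1 then 1 else 0

/-- The coproduct, with `B ⊗ B` realized as `BIdx × BIdx → ℂ`. -/
def ΔTY (f : TYB G) : BIdx G × BIdx G → ℂ := fun qr => ∑ p : BIdx G, f p * Δc G p qr.1 qr.2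

/-- The counit `ε(f^x_{α,β}) = δ_{α,β}`. -/
def εTY (f : TYB G) : ℂ := ∑ p : BIdx G, f p * (if p.1.1 = p.1.2 then 1 else 0)

/-- Translation of an index in `Ω` (`m` unaffected). -/
def shiftΩ : ΩIdx G → G → ΩIdx G
  | Sum.inl h, g => Sum.inl (h - g)
  | Sum.inr u, _ => Sum.inr u

/-- Structure constants of the involution `*`. -/
def starCoef (τ : ℝ) : BIdx G → BIdx G → ℂ := fun p r =>
  match p.1, r.1 with
  | (Sum.inl (g, a), Sum.inl (g', b)), (Sum.inl (g₂, a₂), Sum.inl (g₂', b₂)) =>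
      if g₂ = -g ∧ g₂' = -g' ∧ a₂ = shiftΩ G a g ∧ b₂ = shiftΩ G b g' then 1 else 0
  | (Sum.inr α, Sum.inr β), (Sum.inr α₂, Sum.inr β₂) =>
      if α₂ = α.swap ∧ β₂ = β.swap then
        (match α, β with
          | Sum.inl _, Sum.inr _ => (τ : ℂ)
          | Sum.inr _, Sum.inl _ => (τ : ℂ)⁻¹
          | _, _ => 1)
      else 0
  | _, _ => 0

/-- The (conjugate-linear) involution of the Tambara–Yamagami WHA. -/
def starTY (τ : ℝ) (f : TYB G) : TYB G := fun r =>
  ∑ p : BIdx G, (starRingEnd ℂ) (f p) * starCoef G τ p r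

/-- Structure constants of the antipode `S`. -/
def SCoef (τ : ℝ) : BIdx G → BIdx G → ℂ := fun p r =>
  match p.1, r.1 with
  | (Sum.inl (g, a), Sum.inl (_, b)), (Sum.inl (g₂, a₂), Sum.inl (g₂', b₂)) =>
      if g₂ = -g ∧ g₂' = -g ∧ a₂ = shiftΩ G b g ∧ b₂ = shiftΩ G a g then 1 else 0
  | (Sum.inr α, Sum.inr β), (Sum.inr α₂, Sum.inr β₂) =>
      if α₂ = β.swap ∧ β₂ = α.swap then
        (match α, β with
          | Sum.inl _, Sum.inr _ => (τ : ℂ)⁻¹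
          | Sum.inr _, Sum.inl _ => (τ : ℂ)
          | _, _ => 1)
      else 0
  | _, _ => 0

/-- The antipode of the Tambara–Yamagami WHA. -/
def STY (τ : ℝ) (f : TYB G) : TYB G := fun r => ∑ p : BIdx G, f p * SCoef G τ p r

/-- The right adjoint action `a ◁ x = S(x₍₁₎) a x₍₂₎`. -/
def adTY (χ : G → G → ℂ) (τ : ℝ) (a x : TYB G) : TYB G :=
  ∑ p : BIdx G, ∑ q₁ : BIdx G, ∑ q₂ : BIdx G,
    (x p * Δc G p q₁ q₂) •
      mulTY G χ τ (mulTY G χ τ (STY G τ (Pi.single q₁ 1)) a) (Pi.single q₂ 1)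

/-- `I` is a coideal of the Tambara–Yamagami WHA: a unital `*`-subalgebra with
`Δ(I) ⊆ I ⊗ B`. -/
def IsCoidealTY (χ : G → G → ℂ) (τ : ℝ) (I : Submodule ℂ (TYB G)) : Prop :=
  oneTY G ∈ I ∧ (∀ a ∈ I, ∀ b ∈ I, mulTY G χ τ a b ∈ I) ∧ (∀ a ∈ I, starTY G τ a ∈ I) ∧
    ∀ a ∈ I, ΔTY G a ∈ Submodule.span ℂ
      {t : BIdx G × BIdx G → ℂ | ∃ u ∈ I, ∃ v : TYB G, t = fun qr => u qr.1 * v qr.2}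

/-- `I` is invariant: `span{S(x₍₁₎) a x₍₂₎ : a ∈ I, x ∈ B} = I`. -/
def IsInvariantTY (χ : G → G → ℂ) (τ : ℝ) (I : Submodule ℂ (TYB G)) : Prop :=
  Submodule.span ℂ {y : TYB G | ∃ a ∈ I, ∃ x : TYB G, y = adTY G χ τ a x} = I

/-- The source counital map `ε_s(b) = (id ⊗ ε)((1 ⊗ b)Δ(1))`. -/
def εsTY (χ : G → G → ℂ) (τ : ℝ) (b : TYB G) : TYB G := fun s =>
  ∑ r : BIdx G, (ΔTY G (oneTY G) (s, r)) * εTY G (mulTY G χ τ b (Pi.single r 1))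

/-- `B_s = ε_s(B)`. -/
def BsTY (χ : G → G → ℂ) (τ : ℝ) : Submodule ℂ (TYB G) :=
  Submodule.span ℂ (Set.range (εsTY G χ τ))

/-- `L^⊥ = {g : χ(g,l) = 1 ∀ l ∈ L}`. -/
def Lperp (χ : G → G → ℂ) (L : AddSubgroup G) : Set G := {g : G | ∀ l ∈ L, χ g l = 1}

/-- The element `v^0_Y ⊗ conj (v^0_w)` of `B`, for `Y ⊆ G` and `w ∈ Ω`. -/
def bCoset (Y : Set G) (w : ΩIdx G) : TYB G := fun p =>
  match p.1 with
  | (Sum.inl (g, Sum.inl y), Sum.inl (g', w')) =>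
      if g = 0 ∧ g' = 0 ∧ w' = w ∧ y ∈ Y then 1 else 0
  | _ => 0

/-- The element `v^l_m ⊗ conj (v^l_w)` of `B`, for `l ∈ G` and `w ∈ Ω`. -/
def bM (l : G) (w : ΩIdx G) : TYB G := fun p =>
  match p.1 with
  | (Sum.inl (g, Sum.inr _), Sum.inl (g', w')) => if g = l ∧ g' = l ∧ w' = w then 1 else 0
  | _ => 0

/-- The coideal `I^L = span{v^0_Y : Y ∈ G/L} ⊗ conj(H^0) ⊕ Σ_{l ∈ L^⊥} ℂ v^l_m ⊗ conj(H^l)`. -/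
def ILTY (χ : G → G → ℂ) (L : AddSubgroup G) : Submodule ℂ (TYB G) :=
  Submodule.span ℂ
    ({b : TYB G | ∃ g : G, ∃ w : ΩIdx G, b = bCoset G {x : G | x - g ∈ L} w} ∪
      {b : TYB G | ∃ l ∈ Lperp G χ L, ∃ w : ΩIdx G, b = bM G l w})


/-- The operator `P^h` on `V`. -/
def PhTY (h : G) (v : TYV G) : TYV G := fun i =>
  match i with
  | Sum.inl (g₀, Sum.inl s) => if g₀ = 0 then v (Sum.inl (0, Sum.inl (s - h))) else 0
  | Sum.inl (g₀, Sum.inr _) => v (Sum.inl (g₀, Sum.inr ()))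
  | Sum.inr _ => 0

/-- The operator `P^m` on `V` (with `sign(τ) = τ|G|^{1/2}`). -/
def PmTY (χ : G → G → ℂ) (τ : ℝ) (v : TYV G) : TYV G := fun i =>
  match i with
  | Sum.inl (g₀, Sum.inr _) =>
      ((τ : ℂ) * (Real.sqrt (Fintype.card G) : ℂ)) *
        ∑ k : G, χ g₀ k * v (Sum.inl (0, Sum.inl k))
  | Sum.inl (g₀, Sum.inl p) =>
      if g₀ = 0 then
        ((τ : ℂ)⁻¹ * (Real.sqrt (Fintype.card G) : ℂ)) *
          ∑ g : G, χ g p * v (Sum.inl (g, Sum.inr ()))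
      else 0
  | Sum.inr _ => 0

end TY

section Proof

set_option linter.unusedSectionVars false

variable {G : Type} [AddCommGroup G] [Fintype G] [DecidableEq G]

/-- The map on indices with `S(f_{α,γ})` a multiple of `f_{antiIdx γ, antiIdx α}`. -/
def antiIdx : VIdx G → VIdx G
  | Sum.inl (g, a) => Sum.inl (-g, shiftΩ G a g)
  | Sum.inr α => Sum.inr α.swap

/-- The scalar contributed to `S(f_{α,γ})` by the index `α`. -/
def leftScalar (τ : ℝ) : VIdx G → ℂ
  | Sum.inr (Sum.inr _) => τ
  | _ => 1

/-- The scalar contributed to `S(f_{α,γ})` by the index `γ`. -/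
def rightScalar (τ : ℝ) : VIdx G → ℂ
  | Sum.inr (Sum.inr _) => (τ : ℂ)⁻¹
  | _ => 1

/-- The coefficient of `r` in `(a ∘ b) ∘ c`. -/
def circ₃ (χ : G → G → ℂ) (τ : ℝ) (a b c r : VIdx G) : ℂ :=
  ∑ t, circC G χ τ a b t * circC G χ τ t c r

lemma sum_BIdx (F : VIdx G → VIdx G → ℂ) :
    ∑ s : BIdx G, F s.1.1 s.1.2 =
      ∑ a, ∑ b, if tyGrade G a = tyGrade G b then F a b else 0 := by
  rw [← Fintype.sum_prod_type'
    (f := fun a b => if tyGrade G a = tyGrade G b then F a b else 0), ← Finset.sum_filter]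
  exact (Finset.sum_subtype _ (by simp) (fun s : VIdx G × VIdx G => F s.1 s.2)).symm

lemma tyGrade_antiIdx_eq {a b : VIdx G} (h : tyGrade G a = tyGrade G b) :
    tyGrade G (antiIdx a) = tyGrade G (antiIdx b) := by
  rcases a with ⟨g, a⟩ | a <;> rcases b with ⟨g', b⟩ | b <;> simp_all [tyGrade, antiIdx]

lemma SCoef_eq {τ : ℝ} (hτ : τ ≠ 0) (p r : BIdx G) :
    SCoef G τ p r = if r.1.1 = antiIdx p.1.2 ∧ r.1.2 = antiIdx p.1.1 then
      leftScalar τ p.1.1 * rightScalar τ p.1.2 else 0 := by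
  have hτ' : (τ : ℂ) ≠ 0 := by exact_mod_cast hτ
  obtain ⟨⟨p1, p2⟩, hp⟩ := p
  obtain ⟨⟨r1, r2⟩, hr⟩ := r
  change tyGrade G p1 = tyGrade G p2 at hp
  change tyGrade G r1 = tyGrade G r2 at hr
  rcases p1 with ⟨g, a⟩ | a | a <;> rcases p2 with ⟨g', b⟩ | b | b <;>
    rcases r1 with ⟨h, c⟩ | c | c <;> rcases r2 with ⟨h', d⟩ | d | d <;>
    first
    | (exfalso; simp [tyGrade] at hp; done)
    | (exfalso; simp [tyGrade] at hr; done)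
    | skip
  all_goals simp_all [SCoef, antiIdx, leftScalar, rightScalar]
  obtain rfl : g = g' := by simpa [tyGrade] using hp
  congr 1
  grind

/-- The scalar part of `a ◁ x` on basis vectors. -/
def adC (χ : G → G → ℂ) (τ : ℝ) (p : BIdx G) (a b : VIdx G) (r : BIdx G) : ℂ :=
  ∑ γ, if tyGrade G γ = tyGrade G p.1.1 then
    leftScalar τ p.1.1 * rightScalar τ γ *
      ∑ t : BIdx G, circC G χ τ (antiIdx γ) a t.1.1 * circC G χ τ t.1.1 γ r.1.1 *
        star (circC G χ τ (antiIdx p.1.1) b t.1.2 * circC G χ τ t.1.2 p.1.2 r.1.2)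
  else 0

lemma sum_Δc (p : BIdx G) (F : VIdx G → VIdx G → VIdx G → VIdx G → ℂ) :
    ∑ q₁ : BIdx G, ∑ q₂ : BIdx G, Δc G p q₁ q₂ * F q₁.1.1 q₁.1.2 q₂.1.1 q₂.1.2 =
      ∑ γ, if tyGrade G γ = tyGrade G p.1.1 then F p.1.1 γ γ p.1.2 else 0 := by
  obtain ⟨⟨p1, p2⟩, hp⟩ := p
  have h1 : ∀ q₁ : BIdx G, ∑ q₂ : BIdx G,
      Δc G ⟨(p1, p2), hp⟩ q₁ q₂ * F q₁.1.1 q₁.1.2 q₂.1.1 q₂.1.2 =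
      if q₁.1.1 = p1 then F p1 q₁.1.2 q₁.1.2 p2 else 0 := by
    intro q₁
    obtain ⟨⟨a, b⟩, hq⟩ := q₁
    have := sum_BIdx (fun c d => (if a = p1 ∧ d = p2 ∧ b = c then 1 else 0) * F a b c d)
    simp only [Δc]
    refine this.trans ?_
    change tyGrade G a = tyGrade G b at hq
    change tyGrade G p1 = tyGrade G p2 at hp
    rw [Finset.sum_eq_single b (fun c _ hc => by simp [hc.symm]) (by simp),
      Finset.sum_eq_single p2 (fun d _ hd => by simp [hd]) (by simp)]
    by_cases h : a = p1
    · subst h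
      simp [hq.symm.trans hp]
    · simp [h]
  simp only [h1]
  rw [sum_BIdx (fun a b => if a = p1 then F p1 b b p2 else 0),
    Finset.sum_eq_single p1 (fun a _ ha => by simp [ha]) (by simp)]
  simp [eq_comm]

lemma mul_single_apply (χ : G → G → ℂ) (τ : ℝ) (f : TYB G) (q r : BIdx G) :
    mulTY G χ τ f (Pi.single q 1) r =
      ∑ p : BIdx G, f p * circC G χ τ p.1.1 q.1.1 r.1.1 *
        star (circC G χ τ p.1.2 q.1.2 r.1.2) := by
  unfold mulTY
  refine Finset.sum_congr rfl fun p _ => ?_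
  rw [Finset.sum_eq_single q (by intro b _ hb; simp [Pi.single_eq_of_ne hb]) (by simp)]
  simp

lemma STY_single_mul_apply (χ : G → G → ℂ) {τ : ℝ} (hτ : τ ≠ 0) (q : BIdx G) (a : TYB G)
    (r : BIdx G) :
    mulTY G χ τ (STY G τ (Pi.single q 1)) a r =
      ∑ s : BIdx G, a s * (leftScalar τ q.1.1 * rightScalar τ q.1.2 *
        circC G χ τ (antiIdx q.1.2) s.1.1 r.1.1 *
        star (circC G χ τ (antiIdx q.1.1) s.1.2 r.1.2)) := by
  have hS : ∀ t, STY G τ (Pi.single q 1) t = SCoef G τ q t := by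
    intro t
    unfold STY
    rw [Finset.sum_eq_single q (by intro b _ hb; simp [Pi.single_eq_of_ne hb]) (by simp)]
    simp
  unfold mulTY
  rw [Finset.sum_comm]
  refine Finset.sum_congr rfl fun s _ => ?_
  rw [Finset.sum_eq_single ⟨(antiIdx q.1.2, antiIdx q.1.1), tyGrade_antiIdx_eq q.2.symm⟩]
  · rw [hS, SCoef_eq hτ]
    simp only [and_self, if_true]
    ring
  · intro b _ hb
    rw [hS, SCoef_eq hτ, if_neg]
    · ring
    · rintro ⟨h1, h2⟩
      exact hb (Subtype.ext (Prod.ext h1 h2))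
  · simp

lemma adTY_apply (χ : G → G → ℂ) {τ : ℝ} (hτ : τ ≠ 0) (a x : TYB G) (r : BIdx G) :
    adTY G χ τ a x r = ∑ p, x p * ∑ s : BIdx G, a s * adC χ τ p s.1.1 s.1.2 r := by
  unfold adTY
  simp only [Finset.sum_apply, Pi.smul_apply, smul_eq_mul, mul_single_apply,
    STY_single_mul_apply χ hτ]
  refine Finset.sum_congr rfl fun p _ => ?_
  simp only [mul_assoc (x p), ← Finset.mul_sum]
  congr 1
  rw [sum_Δc p (fun a₁ b₁ a₂ b₂ => ∑ t : BIdx G, (∑ s : BIdx G, a s *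
    (leftScalar τ a₁ * rightScalar τ b₁ * circC G χ τ (antiIdx b₁) s.1.1 t.1.1 *
        star (circC G χ τ (antiIdx a₁) s.1.2 t.1.2))) * circC G χ τ t.1.1 a₂ r.1.1 *
        star (circC G χ τ t.1.2 b₂ r.1.2))]
  simp only [adC, Finset.mul_sum]
  rw [Finset.sum_comm]
  refine Finset.sum_congr rfl fun γ _ => ?_
  split_ifs
  · simp only [Finset.sum_mul, Finset.mul_sum]
    rw [Finset.sum_comm]
    refine Finset.sum_congr rfl fun s _ => Finset.sum_congr rfl fun t _ => ?_
    rw [star_mul']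
    ring
  · simp

/-- The grade of `a ∘ b` when the grades of `a` and `b` are not both `m`. -/
def mulGrade : ΩIdx G → ΩIdx G → ΩIdx G
  | Sum.inl g, Sum.inl h => Sum.inl (g + h)
  | _, _ => Sum.inr ()

lemma tyGrade_of_circC_ne_zero (χ : G → G → ℂ) (τ : ℝ) (a : VIdx G) (g : G) (x : ΩIdx G)
    (t : VIdx G) (h : circC G χ τ a (Sum.inl (g, x)) t ≠ 0) :
    tyGrade G t = mulGrade (tyGrade G a) (Sum.inl g) := by
  rcases a with ⟨k, a | a⟩ | a | a <;> simp only [circC, ne_eq, ite_eq_right_iff, not_forall] at h <;>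
    obtain ⟨⟨-, rfl⟩, -⟩ := h <;> rfl

lemma circC_inl_inl (χ : G → G → ℂ) (τ : ℝ) (g h : G) (k x : ΩIdx G) (r : VIdx G) :
    circC G χ τ (Sum.inl (g, k)) (Sum.inl (h, x)) r =
      if x = shiftΩ G k (-h) ∧ r = Sum.inl (g + h, x) then 1 else 0 := by
  rcases k with k | k <;> simp only [circC, shiftΩ, sub_neg_eq_add]
  · rw [add_comm k h]
    congr 1
    grind
  · congr 1
    grind

/-- The operator `u ↦ Σ_γ c_γ (v_{antiIdx γ} ∘ u) ∘ v_γ`, with `c_γ = rightScalar τ γ` and `γ`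
running over the indices of grade `m`. -/
def adjM (χ : G → G → ℂ) (τ : ℝ) (v : TYV G) : TYV G := fun i =>
  match i with
  | Sum.inl (p, Sum.inr _) => (τ : ℂ) * ∑ k : G, (χ p k)⁻¹ * v (Sum.inl (0, Sum.inl k))
  | Sum.inl (p, Sum.inl s) =>
      if p = 0 then (τ : ℂ)⁻¹ * ∑ g : G, χ g s * v (Sum.inl (g, Sum.inr ())) else 0
  | Sum.inr _ => 0

/-- The first leg of the right adjoint action of `f^x_{α,β}`. -/
def adjOp (χ : G → G → ℂ) (τ : ℝ) : ΩIdx G → TYV G → TYV G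
  | Sum.inl h => PhTY G h
  | Sum.inr _ => adjM χ τ

/-- The matrix of `adjOp`. -/
def adjMat (χ : G → G → ℂ) (τ : ℝ) (x : ΩIdx G) (a r : VIdx G) : ℂ :=
  ∑ γ, if tyGrade G γ = x then rightScalar τ γ * circ₃ χ τ (antiIdx γ) a γ r else 0

lemma circ₃_inr (χ : G → G → ℂ) (τ : ℝ) (γ : VIdx G) (a : MIdx G) (t r : VIdx G) :
    circC G χ τ (antiIdx γ) (Sum.inr a) t * circC G χ τ t γ r = 0 := by
  rcases γ with ⟨g, c | c⟩ | c | c <;> rcases a with a | a <;> rcases t with ⟨h, d | d⟩ | d | d <;>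
    simp [circC, antiIdx, shiftΩ]

lemma circ₃_inl (χ : G → G → ℂ) (τ : ℝ) (a g h : G) (k c y : ΩIdx G) (r : VIdx G) :
    circ₃ χ τ (Sum.inl (a, k)) (Sum.inl (g, c)) (Sum.inl (h, y)) r =
      if c = shiftΩ G k (-g) ∧ y = shiftΩ G c (-h) ∧ r = Sum.inl (a + g + h, y) then 1 else 0 := by
  simp only [circ₃, circC_inl_inl]
  rw [Finset.sum_eq_single (Sum.inl (a + g, c)) (fun t _ ht => by simp [ht]) (by simp),
    circC_inl_inl]
  simp only [ite_and, if_true]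
  split_ifs <;> simp

lemma adjMat_inl (χ : G → G → ℂ) (τ : ℝ) (h g : G) (c : ΩIdx G) (r : VIdx G) :
    adjMat χ τ (Sum.inl h) (Sum.inl (g, c)) r =
      if c = shiftΩ G c (-g) ∧ r = Sum.inl (g, shiftΩ G c (-h)) then 1 else 0 := by
  simp only [adjMat, Fintype.sum_sum_type (α₁ := G × ΩIdx G), Fintype.sum_prod_type, tyGrade]
  rw [Finset.sum_eq_single h (fun b _ hb => by simp [hb]) (by simp)]
  simp only [antiIdx, circ₃_inl, rightScalar, one_mul, if_true, reduceCtorEq, if_false,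
    Finset.sum_const_zero, add_zero]
  rw [Finset.sum_eq_single (shiftΩ G c (-h)) (fun y _ hy => by simp [hy]) (by simp)]
  have : shiftΩ G (shiftΩ G (shiftΩ G c (-h)) h) (-g) = shiftΩ G c (-g) := by
    rcases c with c | c <;> simp [shiftΩ]
  simp [this]

lemma sum_adjMat_inl (χ : G → G → ℂ) (τ : ℝ) (h : G) (u : TYV G) (r : VIdx G) :
    ∑ a : G × ΩIdx G, u (Sum.inl a) * adjMat χ τ (Sum.inl h) (Sum.inl a) r = PhTY G h u r := by
  simp only [Fintype.sum_prod_type, adjMat_inl]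
  rcases r with ⟨g₀, s | s⟩ | r
  · simp [Fintype.sum_sum_type, shiftΩ, PhTY, ite_and]
    refine if_congr Iff.rfl ?_ rfl
    rw [Finset.sum_eq_single (s - h) (fun x _ hx => if_neg fun e => hx (by simp [e])) (by simp)]
    simp
  · simp [Fintype.sum_sum_type, shiftΩ, PhTY, ite_and]
  · simp [PhTY]

lemma circ₃_inr_inl (χ : G → G → ℂ) (τ : ℝ) (k g : G) (c : ΩIdx G) (r : VIdx G) :
    circ₃ χ τ (Sum.inr (Sum.inr k)) (Sum.inl (g, c)) (Sum.inr (Sum.inl k)) r =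
      if c = Sum.inl (g + k) ∧ g = 0 then
        (match r with
          | Sum.inl (p, Sum.inr _) => (τ : ℂ) * (χ p k)⁻¹
          | _ => 0)
      else 0 := by
  simp only [circ₃, circC]
  rw [Finset.sum_eq_single (Sum.inr (Sum.inr (g + k))) (fun t _ ht => by simp [ht]) (by simp)]
  by_cases hg : g = 0
  · subst hg
    rcases r with ⟨p, s | s⟩ | r <;> simp
  · simp [hg]

lemma circ₃_inr_inr (χ : G → G → ℂ) (τ : ℝ) (k l g : G) (c : ΩIdx G) (r : VIdx G) :
    circ₃ χ τ (Sum.inr (Sum.inl k)) (Sum.inl (g, c)) (Sum.inr (Sum.inr l)) r =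
      if c = Sum.inr () ∧ r = Sum.inl (l - k, Sum.inl l) then χ g k else 0 := by
  simp only [circ₃, circC]
  rw [Finset.sum_eq_single (Sum.inr (Sum.inl k)) (fun t _ ht => by simp [ht]) (by simp)]
  simp only [ite_and, if_true]
  split_ifs <;> simp

lemma adjMat_inr (χ : G → G → ℂ) (τ : ℝ) (g : G) (c : ΩIdx G) (r : VIdx G) :
    adjMat χ τ (Sum.inr ()) (Sum.inl (g, c)) r =
      (∑ k, if c = Sum.inl (g + k) ∧ g = 0 then
        (match r with
          | Sum.inl (p, Sum.inr _) => (τ : ℂ) * (χ p k)⁻¹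
          | _ => 0)
      else 0) +
      ∑ k, (τ : ℂ)⁻¹ * if c = Sum.inr () ∧ r = Sum.inl (0, Sum.inl k) then χ g k else 0 := by
  simp [adjMat, Fintype.sum_sum_type, tyGrade, antiIdx, rightScalar, circ₃_inr_inl, circ₃_inr_inr]

lemma sum_adjMat_inr (χ : G → G → ℂ) (τ : ℝ) (u : TYV G) (r : VIdx G) :
    ∑ a : G × ΩIdx G, u (Sum.inl a) * adjMat χ τ (Sum.inr ()) (Sum.inl a) r = adjM χ τ u r := by
  simp only [Fintype.sum_prod_type, adjMat_inr]
  rcases r with ⟨p, s | s⟩ | r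
  · simp [adjM, ite_and]
    refine if_congr Iff.rfl ?_ rfl
    rw [Finset.mul_sum]
    exact Finset.sum_congr rfl fun g _ => by ring
  · simp only [Fintype.sum_sum_type, adjM, reduceCtorEq, false_and, if_false, mul_zero,
      Finset.sum_const_zero, add_zero, Sum.inl.injEq]
    rw [Finset.sum_eq_single 0 (fun g _ hg => by simp [hg]) (by simp), Finset.mul_sum]
    simp
    exact Finset.sum_congr rfl fun k _ => by ring
  · simp [adjM]

lemma sum_adjMat (χ : G → G → ℂ) (τ : ℝ) (x : ΩIdx G) (u : TYV G) (r : VIdx G) :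
    ∑ a : G × ΩIdx G, u (Sum.inl a) * adjMat χ τ x (Sum.inl a) r = adjOp χ τ x u r := by
  rcases x with h | ⟨⟩
  · exact sum_adjMat_inl χ τ h u r
  · exact sum_adjMat_inr χ τ u r

/-- The second leg of the right adjoint action. -/
def adjK (χ : G → G → ℂ) (τ : ℝ) (p : BIdx G) (j r : VIdx G) : ℂ :=
  leftScalar τ p.1.1 * star (circ₃ χ τ (antiIdx p.1.1) j p.1.2 r)

lemma sum_BIdx_mul {A B : VIdx G → ℂ} {z : ΩIdx G} (hA : ∀ t, A t ≠ 0 → tyGrade G t = z)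
    (hB : ∀ t, B t ≠ 0 → tyGrade G t = z) :
    ∑ t : BIdx G, A t.1.1 * B t.1.2 = (∑ t, A t) * ∑ t, B t := by
  rw [sum_BIdx fun a b => A a * B b, Finset.sum_mul_sum]
  refine Finset.sum_congr rfl fun a _ => Finset.sum_congr rfl fun b _ => ?_
  by_cases ha : A a = 0
  · simp [ha]
  by_cases hb : B b = 0
  · simp [hb]
  rw [if_pos ((hA a ha).trans (hB b hb).symm)]

lemma adC_inl (χ : G → G → ℂ) (τ : ℝ) (p : BIdx G) (a : G × ΩIdx G) (j : VIdx G) (r : BIdx G)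
    (h : tyGrade G (Sum.inl a) = tyGrade G j) :
    adC χ τ p (Sum.inl a) j r =
      adjK χ τ p j r.1.2 * adjMat χ τ (tyGrade G p.1.1) (Sum.inl a) r.1.1 := by
  obtain ⟨g, a⟩ := a
  rcases j with ⟨g', d⟩ | j
  swap
  · simp [tyGrade] at h
  obtain rfl : g = g' := by simpa [tyGrade] using h
  simp only [adC, adjMat, Finset.mul_sum, mul_ite, mul_zero]
  refine Finset.sum_congr rfl fun γ _ => ?_
  split_ifs with hγ
  · simp only [star_mul', adjK, circ₃, star_sum]
    have key := sum_BIdx_mul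
      (A := fun t => circC G χ τ (antiIdx γ) (Sum.inl (g, a)) t * circC G χ τ t γ r.1.1)
      (B := fun t => star (circC G χ τ (antiIdx p.1.1) (Sum.inl (g, d)) t) *
        star (circC G χ τ t p.1.2 r.1.2)) (z := mulGrade (tyGrade G (antiIdx p.1.1)) (Sum.inl g))
      (fun t ht => by
        rw [tyGrade_of_circC_ne_zero χ τ _ _ _ t (left_ne_zero_of_mul ht),
          tyGrade_antiIdx_eq hγ])
      (fun t ht => tyGrade_of_circC_ne_zero χ τ _ _ _ t (star_ne_zero.mp (left_ne_zero_of_mul ht)))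
    rw [← Finset.mul_sum, key]
    ring
  · rfl

lemma adC_inr (χ : G → G → ℂ) (τ : ℝ) (p : BIdx G) (a : MIdx G) (j : VIdx G) (r : BIdx G) :
    adC χ τ p (Sum.inr a) j r = 0 := by
  simp [adC, circ₃_inr]

lemma adTY_single (χ : G → G → ℂ) {τ : ℝ} (hτ : τ ≠ 0) (a : TYB G) (p r : BIdx G) :
    adTY G χ τ a (Pi.single p 1) r = ∑ s : BIdx G, a s * adC χ τ p s.1.1 s.1.2 r := by
  rw [adTY_apply χ hτ, Finset.sum_eq_single p
    (fun b _ hb => by rw [Pi.single_eq_of_ne hb, zero_mul]) (by simp), Pi.single_eq_same, one_mul]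

/-- The element `u ⊗ conj v_j` of `B`. -/
def tenB (u : TYV G) (j : VIdx G) : TYB G := fun p => if p.1.2 = j then u p.1.1 else 0

lemma adTY_tenB (χ : G → G → ℂ) {τ : ℝ} (hτ : τ ≠ 0) {u : TYV G} {j : VIdx G}
    (hu : ∀ i, tyGrade G i ≠ tyGrade G j → u i = 0) (p r : BIdx G) :
    adTY G χ τ (tenB u j) (Pi.single p 1) r =
      adjK χ τ p j r.1.2 * adjOp χ τ (tyGrade G p.1.1) u r.1.1 := by
  rw [adTY_single χ hτ, ← sum_adjMat, Finset.mul_sum]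
  simp only [tenB]
  rw [sum_BIdx fun a b => (if b = j then u a else 0) * adC χ τ p a b r]
  have : ∀ a, (∑ b, if tyGrade G a = tyGrade G b then
      (if b = j then u a else 0) * adC χ τ p a b r else 0) = u a * adC χ τ p a j r := by
    intro a
    rw [Finset.sum_eq_single j (fun b _ hb => by simp [hb]) (by simp)]
    by_cases h : tyGrade G a = tyGrade G j
    · simp [h]
    · simp [hu a h]
  simp only [this, Fintype.sum_sum_type (α₁ := G × ΩIdx G), adC_inr, mul_zero,
    Finset.sum_const_zero, add_zero]
  refine Finset.sum_congr rfl fun a _ => ?_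
  by_cases h : tyGrade G (Sum.inl a) = tyGrade G j
  · rw [adC_inl χ τ p a j r h]
    ring
  · simp [hu _ h]

/-- The linear map underlying `adjOp`. -/
def adjOpL (χ : G → G → ℂ) (τ : ℝ) (x : ΩIdx G) : TYV G →ₗ[ℂ] TYV G where
  toFun := adjOp χ τ x
  map_add' u v := by
    funext i
    rcases x with h | x <;> rcases i with ⟨g, s | s⟩ | i <;>
      simp only [adjOp, PhTY, adjM, Pi.add_apply, mul_add, Finset.sum_add_distrib, add_zero] <;>
      split_ifs <;> simp
  map_smul' c u := by
    funext i
    rcases x with h | x <;> rcases i with ⟨g, s | s⟩ | i <;>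
      simp only [adjOp, PhTY, adjM, Pi.smul_apply, smul_eq_mul, RingHom.id_apply, mul_zero,
        mul_left_comm _ c, ← Finset.mul_sum] <;>
      split_ifs <;> simp

/-- The linear map underlying `PmTY`. -/
def PmL (χ : G → G → ℂ) (τ : ℝ) : TYV G →ₗ[ℂ] TYV G where
  toFun := PmTY G χ τ
  map_add' u v := by
    funext i
    rcases i with ⟨g, s | s⟩ | i <;>
      simp only [PmTY, Pi.add_apply, mul_add, Finset.sum_add_distrib, add_zero]
    split_ifs <;> simp
  map_smul' c u := by
    funext i
    rcases i with ⟨g, s | s⟩ | i <;>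
      simp only [PmTY, Pi.smul_apply, smul_eq_mul, RingHom.id_apply, mul_zero,
        mul_left_comm _ c, ← Finset.mul_sum]
    split_ifs <;> simp

/-- The projection of `V` onto `H^y`. -/
def gradeProj (y : ΩIdx G) : TYV G →ₗ[ℂ] TYV G where
  toFun v i := if tyGrade G i = y then v i else 0
  map_add' u v := by funext i; simp only [Pi.add_apply]; split_ifs <;> simp
  map_smul' c u := by funext i; simp

lemma gradeProj_apply (y : ΩIdx G) (v : TYV G) (i : VIdx G) :
    gradeProj y v i = if tyGrade G i = y then v i else 0 := rfl

lemma gradeProj_of_graded {y : ΩIdx G} {u : TYV G} (hu : ∀ i, tyGrade G i ≠ y → u i = 0)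
    (z : ΩIdx G) : gradeProj z u = if y = z then u else 0 := by
  funext i
  by_cases hi : tyGrade G i = y
  · subst hi
    rw [gradeProj_apply]
    split_ifs <;> rfl
  · rw [gradeProj_apply]
    split_ifs <;> simp [hu i hi]

lemma sum_gradeProj (u : TYV G) : ∑ y, gradeProj y u = u := by
  funext i
  simp [Finset.sum_apply, gradeProj_apply]

lemma mem_iSup_iff_gradeProj {X : ΩIdx G → Submodule ℂ (TYV G)}
    (hX : ∀ y, ∀ u ∈ X y, ∀ i, tyGrade G i ≠ y → u i = 0) {u : TYV G} :
    u ∈ ⨆ y, X y ↔ ∀ y, gradeProj y u ∈ X y := by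
  constructor
  · intro hu y
    have : ⨆ y, X y ≤ (X y).comap (gradeProj y) := by
      refine iSup_le fun z v hv => ?_
      rw [Submodule.mem_comap, gradeProj_of_graded (hX z v hv)]
      split_ifs with h
      · exact h ▸ hv
      · exact zero_mem _
    exact this hu
  · intro hu
    rw [← sum_gradeProj u]
    exact sum_mem fun y _ => Submodule.mem_iSup_of_mem y (hu y)

/-- The coefficient of `conj v_j` in an element of `B`. -/
def slice (j : VIdx G) : TYB G →ₗ[ℂ] TYV G where
  toFun f i := if h : tyGrade G i = tyGrade G j then f ⟨(i, j), h⟩ else 0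
  map_add' u v := by funext i; simp only [Pi.add_apply]; split_ifs <;> simp
  map_smul' c u := by funext i; simp

lemma slice_tenB (u : TYV G) (j k : VIdx G) :
    slice k (tenB u j) = if k = j then gradeProj (tyGrade G j) u else 0 := by
  funext i
  by_cases hk : k = j
  · subst hk
    simp [slice, tenB, gradeProj_apply]
  · simp [slice, tenB, hk]

lemma sum_tenB_slice (f : TYB G) : ∑ j, tenB (slice j f) j = f := by
  funext r
  obtain ⟨⟨a, b⟩, h⟩ := r
  change tyGrade G a = tyGrade G b at h
  simp [Finset.sum_apply, tenB, slice, h]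

lemma slice_adTY_tenB (χ : G → G → ℂ) {τ : ℝ} (hτ : τ ≠ 0) {u : TYV G} {j : VIdx G}
    (hu : ∀ i, tyGrade G i ≠ tyGrade G j → u i = 0) (p : BIdx G) (k : VIdx G) :
    slice k (adTY G χ τ (tenB u j) (Pi.single p 1)) =
      adjK χ τ p j k • gradeProj (tyGrade G k) (adjOp χ τ (tyGrade G p.1.1) u) := by
  funext i
  by_cases h : tyGrade G i = tyGrade G k
  · simp [slice, gradeProj_apply, h, adTY_tenB χ hτ hu]
  · simp [slice, gradeProj_apply, h]

/-- The subspace `Σ_y X^y ⊗ conj(H^y)` of `B`. -/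
def tenSpan (X : ΩIdx G → Submodule ℂ (TYV G)) : Submodule ℂ (TYB G) :=
  Submodule.span ℂ {b | ∃ y, ∃ u ∈ X y, ∃ j, tyGrade G j = y ∧ b = tenB u j}

lemma mem_tenSpan_iff {X : ΩIdx G → Submodule ℂ (TYV G)}
    (hX : ∀ y, ∀ u ∈ X y, ∀ i, tyGrade G i ≠ y → u i = 0) {f : TYB G} :
    f ∈ tenSpan X ↔ ∀ j, slice j f ∈ X (tyGrade G j) := by
  constructor
  · intro hf j
    have : tenSpan X ≤ (X (tyGrade G j)).comap (slice j) := by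
      refine Submodule.span_le.mpr ?_
      rintro _ ⟨_, u, hu, k, rfl, rfl⟩
      rw [SetLike.mem_coe, Submodule.mem_comap, slice_tenB]
      split_ifs with h
      · subst h
        rwa [gradeProj_of_graded (hX _ u hu), if_pos rfl]
      · exact zero_mem _
    exact this hf
  · intro h
    rw [← sum_tenB_slice f]
    exact sum_mem fun j _ => Submodule.subset_span ⟨_, _, h j, j, rfl, rfl⟩

lemma adTY_mem (χ : G → G → ℂ) {τ : ℝ} (hτ : τ ≠ 0) {X : ΩIdx G → Submodule ℂ (TYV G)}
    {N : Submodule ℂ (TYB G)}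
    (hN : ∀ j, ∀ u ∈ X (tyGrade G j), ∀ p, adTY G χ τ (tenB u j) (Pi.single p 1) ∈ N)
    {a : TYB G} (ha : a ∈ tenSpan X) (x : TYB G) : adTY G χ τ a x ∈ N := by
  have hx : adTY G χ τ a x = ∑ p, x p • adTY G χ τ a (Pi.single p 1) := by
    funext r
    simp only [Finset.sum_apply, Pi.smul_apply, smul_eq_mul, adTY_single χ hτ]
    exact adTY_apply χ hτ a x r
  rw [hx]
  refine sum_mem fun p _ => N.smul_mem _ ?_
  clear hx
  induction ha using Submodule.span_induction with
  | mem a ha =>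
    obtain ⟨_, u, hu, j, rfl, rfl⟩ := ha
    exact hN j u hu p
  | zero =>
    convert N.zero_mem
    funext r
    simp [adTY_single χ hτ]
  | add a b _ _ ha hb =>
    convert N.add_mem ha hb
    funext r
    simp only [adTY_single χ hτ, Pi.add_apply, add_mul, Finset.sum_add_distrib]
  | smul c a _ ha =>
    convert N.smul_mem c ha
    funext r
    simp only [adTY_single χ hτ, Pi.smul_apply, smul_eq_mul, Finset.mul_sum, mul_assoc]

/-- The span of the vectors `v^0_k` and `v^g_m`. -/
def suppV (G : Type) [AddCommGroup G] : Submodule ℂ (TYV G) where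
  carrier := {v | (∀ i, v (Sum.inr i) = 0) ∧ ∀ g k, g ≠ 0 → v (Sum.inl (g, Sum.inl k)) = 0}
  add_mem' := by
    rintro u v ⟨h1, h2⟩ ⟨h3, h4⟩
    exact ⟨fun i => by simp [h1, h3], fun g k hg => by simp [h2 g k hg, h4 g k hg]⟩
  zero_mem' := ⟨fun _ => rfl, fun _ _ _ => rfl⟩
  smul_mem' := by
    rintro c u ⟨h1, h2⟩
    exact ⟨fun i => by simp [h1], fun g k hg => by simp [h2 g k hg]⟩

lemma adjOp_mem_suppV (χ : G → G → ℂ) (τ : ℝ) (x : ΩIdx G) (u : TYV G) :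
    adjOp χ τ x u ∈ suppV G := by
  rcases x with h | x
  · exact ⟨fun _ => rfl, fun _ _ hg => if_neg hg⟩
  · exact ⟨fun _ => rfl, fun _ _ hg => if_neg hg⟩

lemma gradeProj_mem_suppV (y : ΩIdx G) {u : TYV G} (hu : u ∈ suppV G) :
    gradeProj y u ∈ suppV G := by
  refine ⟨fun i => ?_, fun g k hg => ?_⟩
  · simp [gradeProj_apply, hu.1 i]
  · simp [gradeProj_apply, hu.2 g k hg]

lemma PhTY_zero {u : TYV G} (hu : u ∈ suppV G) : PhTY G 0 u = u := by
  funext i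
  rcases i with ⟨g, s | s⟩ | i
  · by_cases hg : g = 0
    · simp [PhTY, hg]
    · simp [PhTY, hg, hu.2 g s hg]
  · rfl
  · simp [PhTY, hu.1 i]

lemma PhTY_PhTY (h h' : G) (u : TYV G) : PhTY G h (PhTY G h' u) = PhTY G (h + h') u := by
  funext i
  rcases i with ⟨g, s | s⟩ | i <;> simp [PhTY, sub_sub]

lemma adjOp_eq_zero (χ : G → G → ℂ) (τ : ℝ) (x : ΩIdx G) {u : TYV G}
    (hu : ∀ i, tyGrade G i ≠ Sum.inr () → u i = 0) : adjOp χ τ x u = 0 := by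
  have h : ∀ a, u (Sum.inl a) = 0 := fun a => hu _ (by simp [tyGrade])
  funext r
  rw [← sum_adjMat]
  simp [h]

section Character

variable {χ : G → G → ℂ} (hχsymm : ∀ g h : G, χ g h = χ h g)
  (hχadd : ∀ g g' h : G, χ (g + g') h = χ g h * χ g' h) (hχnorm : ∀ g h : G, ‖χ g h‖ = 1)
  (hχnondeg : ∀ g : G, (∀ h : G, χ g h = 1) → g = 0)

include hχnorm

lemma chi_ne_zero (g h : G) : χ g h ≠ 0 := by
  rw [← norm_ne_zero_iff, hχnorm]
  exact one_ne_zero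

include hχadd

lemma chi_zero (h : G) : χ 0 h = 1 := by
  have := hχadd 0 0 h
  rw [add_zero] at this
  exact (mul_eq_left₀ (chi_ne_zero hχnorm 0 h)).mp this.symm

lemma chi_neg (g h : G) : χ (-g) h = (χ g h)⁻¹ := by
  refine eq_inv_of_mul_eq_one_left ?_
  rw [← hχadd, neg_add_cancel, chi_zero hχadd hχnorm]

include hχsymm hχnondeg

lemma sum_chi (a : G) : ∑ k, χ a k = if a = 0 then (Fintype.card G : ℂ) else 0 := by
  split_ifs with ha
  · simp [ha, chi_zero hχadd hχnorm]
  · obtain ⟨h, hh⟩ : ∃ h, χ a h ≠ 1 := by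
      by_contra! hc
      exact ha (hχnondeg a hc)
    have h1 : ∑ k, χ a k = χ a h * ∑ k, χ a k := by
      rw [Finset.mul_sum, ← Equiv.sum_comp (Equiv.addLeft h)]
      refine Finset.sum_congr rfl fun k _ => ?_
      rw [Equiv.coe_addLeft, hχsymm, hχadd, hχsymm h, hχsymm k]
    by_contra hs
    exact hh ((mul_eq_right₀ hs).mp h1.symm)

lemma sum_chi_sum_chi (f : G → ℂ) (g : G) :
    ∑ k, χ g k * ∑ h, χ h k * f h = Fintype.card G * f (-g) := by
  have : ∀ k, χ g k * ∑ h, χ h k * f h = ∑ h, χ (g + h) k * f h := fun k => by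
    rw [Finset.mul_sum]
    exact Finset.sum_congr rfl fun h _ => by rw [hχadd]; ring
  simp only [this]
  rw [Finset.sum_comm]
  simp only [← Finset.sum_mul, sum_chi hχsymm hχadd hχnorm hχnondeg, add_eq_zero_iff_eq_neg']
  rw [Finset.sum_eq_single (-g) (fun h _ hh => by simp [hh]) (by simp)]
  simp

lemma PmTY_PmTY {τ : ℝ} (hτ : τ ≠ 0) (u : TYV G) :
    (∀ s, PmTY G χ τ (PmTY G χ τ u) (Sum.inl (0, Sum.inl s)) =
      (Fintype.card G : ℂ) ^ 2 * u (Sum.inl (0, Sum.inl (-s)))) ∧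
    ∀ g s, PmTY G χ τ (PmTY G χ τ u) (Sum.inl (g, Sum.inr s)) =
      (Fintype.card G : ℂ) ^ 2 * u (Sum.inl (-g, Sum.inr s)) := by
  have hτ' : (τ : ℂ) ≠ 0 := by exact_mod_cast hτ
  have hsq : (Real.sqrt (Fintype.card G) : ℂ) * Real.sqrt (Fintype.card G) = Fintype.card G := by
    rw [← Complex.ofReal_mul, Real.mul_self_sqrt (Nat.cast_nonneg _), Complex.ofReal_natCast]
  refine ⟨fun s => ?_, fun g s => ?_⟩
  · simp only [PmTY, if_true, mul_left_comm (χ _ _), ← Finset.mul_sum]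
    have h1 : ∑ g, χ g s * ∑ k, χ g k * u (Sum.inl (0, Sum.inl k)) =
        ∑ g, χ s g * ∑ k, χ k g * u (Sum.inl (0, Sum.inl k)) :=
      Finset.sum_congr rfl fun g _ => by
        rw [hχsymm g s]
        simp only [hχsymm g]
    rw [h1, sum_chi_sum_chi hχsymm hχadd hχnorm hχnondeg
      (fun k => u (Sum.inl (0, Sum.inl k))) s]
    linear_combination (τ : ℂ) * (τ : ℂ)⁻¹ * (Fintype.card G : ℂ) * u (Sum.inl (0, Sum.inl (-s))) *
      hsq + (Fintype.card G : ℂ) ^ 2 * u (Sum.inl (0, Sum.inl (-s))) * mul_inv_cancel₀ hτ'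
  · simp only [PmTY, if_true, mul_left_comm (χ _ _), ← Finset.mul_sum]
    rw [sum_chi_sum_chi hχsymm hχadd hχnorm hχnondeg (fun k => u (Sum.inl (k, Sum.inr ()))) g]
    linear_combination (τ : ℂ) * (τ : ℂ)⁻¹ * (Fintype.card G : ℂ) * u (Sum.inl (-g, Sum.inr s)) *
      hsq + (Fintype.card G : ℂ) ^ 2 * u (Sum.inl (-g, Sum.inr s)) * mul_inv_cancel₀ hτ'

lemma PmTY_pow_four {τ : ℝ} (hτ : τ ≠ 0) {u : TYV G} (hu : u ∈ suppV G) :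
    PmTY G χ τ (PmTY G χ τ (PmTY G χ τ (PmTY G χ τ u))) = (Fintype.card G : ℂ) ^ 4 • u := by
  have key := PmTY_PmTY hχsymm hχadd hχnorm hχnondeg hτ
  funext i
  rcases i with ⟨g, s | s⟩ | i
  · by_cases hg : g = 0
    · subst hg
      rw [(key _).1, (key _).1, neg_neg, Pi.smul_apply, smul_eq_mul]
      ring
    · rw [Pi.smul_apply, hu.2 g s hg, smul_zero]
      exact if_neg hg
  · rw [(key _).2, (key _).2, neg_neg, Pi.smul_apply, smul_eq_mul]
    ring
  · rw [Pi.smul_apply, hu.1 i, smul_zero]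
    rfl

omit hχsymm hχnondeg

lemma gradeProj_adjM_of_ne_zero (τ : ℝ) (u : TYV G) {p : G} (hp : p ≠ 0) :
    gradeProj (Sum.inl p) (adjM χ τ u) =
      ((τ : ℂ) * ∑ k, χ (-p) k * u (Sum.inl (0, Sum.inl k))) •
        Pi.single (Sum.inl (p, Sum.inr ())) 1 := by
  funext i
  rcases i with ⟨g, s | s⟩ | i
  · by_cases hg : g = p <;> simp [gradeProj_apply, tyGrade, adjM, hg, hp]
  · by_cases hg : g = p
    · subst hg
      simp [gradeProj_apply, tyGrade, adjM, chi_neg hχadd hχnorm]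
    · simp [gradeProj_apply, tyGrade, hg]
  · simp [gradeProj_apply, tyGrade]

lemma gradeProj_zero_PmTY (τ : ℝ) (u : TYV G) :
    gradeProj (Sum.inl 0) (PmTY G χ τ u) =
      (Real.sqrt (Fintype.card G) : ℂ) • gradeProj (Sum.inl 0) (adjM χ τ u) := by
  funext i
  rcases i with ⟨g, s | s⟩ | i
  · by_cases hg : g = 0
    · simp [gradeProj_apply, tyGrade, PmTY, adjM, hg]
      ring
    · simp [gradeProj_apply, tyGrade, hg]
  · by_cases hg : g = 0
    · simp [gradeProj_apply, tyGrade, PmTY, adjM, hg, chi_zero hχadd hχnorm]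
      ring
    · simp [gradeProj_apply, tyGrade, hg]
  · simp [gradeProj_apply, tyGrade]

omit hχadd hχnorm

lemma gradeProj_PmTY_of_ne_zero (τ : ℝ) (u : TYV G) {p : G} (hp : p ≠ 0) :
    gradeProj (Sum.inl p) (PmTY G χ τ u) =
      ((τ : ℂ) * (Real.sqrt (Fintype.card G) : ℂ) *
          ∑ k, χ p k * u (Sum.inl (0, Sum.inl k))) •
        Pi.single (Sum.inl (p, Sum.inr ())) 1 := by
  funext i
  rcases i with ⟨g, s | s⟩ | i
  · by_cases hg : g = p <;> simp [gradeProj_apply, tyGrade, PmTY, hg, hp]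
  · by_cases hg : g = p
    · subst hg
      simp [gradeProj_apply, tyGrade, PmTY]
    · simp [gradeProj_apply, tyGrade, hg]
  · simp [gradeProj_apply, tyGrade]

lemma slice_starTY_single (τ : ℝ) (p : G) :
    slice (Sum.inl (-p, Sum.inr ())) (starTY G τ
      (tenB (Pi.single (Sum.inl (p, Sum.inr ())) 1) (Sum.inl (p, Sum.inr ())))) =
      Pi.single (Sum.inl (-p, Sum.inr ())) 1 := by
  have h : tenB (Pi.single (Sum.inl (p, Sum.inr ())) 1) (Sum.inl (p, Sum.inr ())) =
      Pi.single (⟨(Sum.inl (p, Sum.inr ()), Sum.inl (p, Sum.inr ())), rfl⟩ : BIdx G) 1 := by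
    funext ⟨⟨a, b⟩, hab⟩
    simp only [tenB, Pi.single_apply, Subtype.mk.injEq, Prod.mk.injEq]
    split_ifs <;> simp_all
  rw [h]
  have hs : ∀ r, starTY G τ (Pi.single (⟨(Sum.inl (p, Sum.inr ()), Sum.inl (p, Sum.inr ())), rfl⟩ :
      BIdx G) 1) r = starCoef G τ ⟨(Sum.inl (p, Sum.inr ()), Sum.inl (p, Sum.inr ())), rfl⟩ r := by
    intro r
    unfold starTY
    rw [Finset.sum_eq_single _ (fun b _ hb => by rw [Pi.single_eq_of_ne hb]; simp) (by simp),
      Pi.single_eq_same, map_one, one_mul]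
  funext i
  rcases i with ⟨g, s | s⟩ | i
  · simp [slice, hs, starCoef, shiftΩ]
  · by_cases hg : g = -p
    · subst hg
      simp [slice, hs, starCoef, shiftΩ]
    · simp [slice, tyGrade, hg]
  · simp [slice, tyGrade]

lemma single_m_mem_neg {τ : ℝ} {X : ΩIdx G → Submodule ℂ (TYV G)}
    (hX : ∀ y, ∀ u ∈ X y, ∀ i, tyGrade G i ≠ y → u i = 0)
    (hstar : ∀ a ∈ tenSpan X, starTY G τ a ∈ tenSpan X) {p : G}
    (h : Pi.single (Sum.inl (p, Sum.inr ())) 1 ∈ X (Sum.inl p)) :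
    Pi.single (Sum.inl (-p, Sum.inr ())) 1 ∈ X (Sum.inl (-p)) := by
  rw [← slice_starTY_single τ p]
  exact (mem_tenSpan_iff hX).mp
    (hstar _ (Submodule.subset_span ⟨Sum.inl p, _, h, Sum.inl (p, Sum.inr ()), rfl, rfl⟩))
    (Sum.inl (-p, Sum.inr ()))

include hχadd hχnorm

lemma gradeProj_adjM_mem_iff {τ : ℝ} (hτ : τ ≠ 0) {X : ΩIdx G → Submodule ℂ (TYV G)}
    (hX : ∀ y, ∀ u ∈ X y, ∀ i, tyGrade G i ≠ y → u i = 0)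
    (hstar : ∀ a ∈ tenSpan X, starTY G τ a ∈ tenSpan X) (u : TYV G) :
    (∀ y, gradeProj y (adjM χ τ u) ∈ X y) ↔ ∀ y, gradeProj y (PmTY G χ τ u) ∈ X y := by
  have hτ' : (τ : ℂ) ≠ 0 := by exact_mod_cast hτ
  have hG : (Real.sqrt (Fintype.card G) : ℂ) ≠ 0 := by
    rw [Complex.ofReal_ne_zero, Real.sqrt_ne_zero (Nat.cast_nonneg _)]
    exact_mod_cast Fintype.card_ne_zero
  have hsmul : ∀ (c : ℂ) (v : TYV G) (N : Submodule ℂ (TYV G)), c • v ∈ N ↔ c = 0 ∨ v ∈ N := by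
    intro c v N
    by_cases hc : c = 0
    · simp [hc]
    · simp [hc, Submodule.smul_mem_iff]
  have hm : ∀ w : TYV G, (∀ i, w (Sum.inr i) = 0) → gradeProj (Sum.inr ()) w = 0 := by
    intro w hw
    funext i
    rcases i with i | i <;> simp [gradeProj_apply, tyGrade, hw]
  have key : ∀ p, gradeProj (Sum.inl p) (adjM χ τ u) ∈ X (Sum.inl p) ↔
      gradeProj (Sum.inl (-p)) (PmTY G χ τ u) ∈ X (Sum.inl (-p)) := by
    intro p
    by_cases hp : p = 0
    · rw [hp, neg_zero, gradeProj_zero_PmTY hχadd hχnorm, hsmul]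
      simp [hG]
    · rw [gradeProj_adjM_of_ne_zero hχadd hχnorm τ u hp,
        gradeProj_PmTY_of_ne_zero τ u (neg_ne_zero.mpr hp), hsmul, hsmul]
      have : Pi.single (Sum.inl (p, Sum.inr ())) 1 ∈ X (Sum.inl p) ↔
          Pi.single (Sum.inl (-p, Sum.inr ())) 1 ∈ X (Sum.inl (-p)) :=
        ⟨single_m_mem_neg hX hstar, fun h => by
          simpa only [neg_neg] using single_m_mem_neg hX hstar h⟩
      rw [this]
      simp [hτ', hG]
  rw [Sum.forall, Sum.forall]
  refine and_congr ((forall_congr' key).trans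
    (neg_surjective.forall (p := fun p : G =>
      gradeProj (Sum.inl p) (PmTY G χ τ u) ∈ X (Sum.inl p))).symm) ?_
  simp [hm _ fun _ => show adjM χ τ u (Sum.inr _) = 0 from rfl,
    hm _ fun _ => show PmTY G χ τ u (Sum.inr _) = 0 from rfl]

end Character

section Invariance

variable {χ : G → G → ℂ} {τ : ℝ} (hτ : τ ≠ 0) {X : ΩIdx G → Submodule ℂ (TYV G)}
  (hX : ∀ y, ∀ u ∈ X y, ∀ i, tyGrade G i ≠ y → u i = 0)

include hτ hX

lemma adTY_tenB_mem (hop : ∀ x y z, ∀ u ∈ X y, gradeProj z (adjOp χ τ x u) ∈ X z) {j : VIdx G}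
    {u : TYV G} (hu : u ∈ X (tyGrade G j)) (p : BIdx G) :
    adTY G χ τ (tenB u j) (Pi.single p 1) ∈ tenSpan X := by
  rw [mem_tenSpan_iff hX]
  intro k
  rw [slice_adTY_tenB χ hτ (hX _ u hu)]
  exact Submodule.smul_mem _ _ (hop _ _ _ u hu)

/-- Acting by `f^0_{c,d}`, with `c = d - g`, on `u ⊗ conj v^g_d`. -/
lemma adTY_tenB_self {g : G} {d : ΩIdx G} {u : TYV G} (hu : u ∈ X (Sum.inl g))
    (hs : u ∈ suppV G) :
    adTY G χ τ (tenB u (Sum.inl (g, d)))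
      (Pi.single ⟨(Sum.inl (0, shiftΩ G d g), Sum.inl (0, d)), rfl⟩ 1) =
      tenB u (Sum.inl (g, d)) := by
  have hg : shiftΩ G (shiftΩ G d g) (-g) = d := by rcases d with d | d <;> simp [shiftΩ]
  have h0 : ∀ c : ΩIdx G, shiftΩ G c 0 = c := by intro c; rcases c with c | c <;> simp [shiftΩ]
  funext r
  rw [adTY_tenB χ hτ (j := Sum.inl (g, d)) (hX (Sum.inl g) u hu)]
  simp [adjK, antiIdx, leftScalar, circ₃_inl, h0, hg, tyGrade, adjOp, PhTY_zero hs, tenB]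

lemma isInvariantTY_of_adjOp (hs : ⨆ y, X y ≤ suppV G)
    (hop : ∀ x y z, ∀ u ∈ X y, gradeProj z (adjOp χ τ x u) ∈ X z) :
    IsInvariantTY G χ τ (tenSpan X) := by
  refine le_antisymm (Submodule.span_le.mpr ?_) (Submodule.span_le.mpr ?_)
  · rintro _ ⟨a, ha, x, rfl⟩
    exact adTY_mem χ hτ (fun j u hu p => adTY_tenB_mem hτ hX hop hu p) ha x
  · rintro _ ⟨_, u, hu, j, rfl, rfl⟩
    have hus : u ∈ suppV G := hs (Submodule.mem_iSup_of_mem _ hu)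
    rcases j with ⟨g, d⟩ | j
    · exact Submodule.subset_span ⟨_, Submodule.subset_span ⟨_, u, hu, _, rfl, rfl⟩, _,
        (adTY_tenB_self hτ hX hu hus).symm⟩
    · have : u = 0 := by
        funext i
        rcases i with i | i
        · exact hX _ u hu _ (by simp [tyGrade])
        · exact hus.1 i
      have h0 : tenB u (Sum.inr j) = 0 := by
        funext p
        simp [tenB, this]
      rw [h0]
      exact zero_mem _

lemma le_suppV_of_isInvariantTY (hinv : IsInvariantTY G χ τ (tenSpan X)) :
    ⨆ y, X y ≤ suppV G := by
  let N : Submodule ℂ (TYB G) := ⨅ j, (suppV G).comap (slice j)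
  have hN : tenSpan X ≤ N := by
    rw [← hinv, Submodule.span_le]
    rintro _ ⟨a, ha, x, rfl⟩
    refine adTY_mem χ hτ (X := X) (fun j u hu p => ?_) ha x
    simp only [N, Submodule.mem_iInf, Submodule.mem_comap]
    intro k
    rw [slice_adTY_tenB χ hτ (hX _ u hu)]
    exact Submodule.smul_mem _ _ (gradeProj_mem_suppV _ (adjOp_mem_suppV χ τ _ u))
  refine iSup_le fun y u hu => ?_
  obtain ⟨j, rfl⟩ : ∃ j, tyGrade G j = y := by
    rcases y with g | y
    · exact ⟨Sum.inl (g, Sum.inr ()), rfl⟩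
    · exact ⟨Sum.inr (Sum.inl 0), rfl⟩
  have := hN (Submodule.subset_span ⟨_, u, hu, j, rfl, rfl⟩)
  simp only [N, Submodule.mem_iInf, Submodule.mem_comap] at this
  have hj := this j
  rwa [slice_tenB, if_pos rfl, gradeProj_of_graded (hX _ u hu), if_pos rfl] at hj

lemma adjOp_mem_of_isInvariantTY (hχ : ∀ g h, χ g h ≠ 0)
    (hinv : IsInvariantTY G χ τ (tenSpan X)) (x y z : ΩIdx G) {u : TYV G} (hu : u ∈ X y) :
    gradeProj z (adjOp χ τ x u) ∈ X z := by
  have had : ∀ a ∈ tenSpan X, ∀ b, adTY G χ τ a b ∈ tenSpan X := fun a ha b =>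
    hinv.le (Submodule.subset_span ⟨a, ha, b, rfl⟩)
  have key : ∀ j, u ∈ X (tyGrade G j) → ∀ (p : BIdx G) k, adjK χ τ p j k ≠ 0 →
      gradeProj (tyGrade G k) (adjOp χ τ (tyGrade G p.1.1) u) ∈ X (tyGrade G k) := by
    intro j hu p k hk
    have := (mem_tenSpan_iff hX).mp
      (had _ (Submodule.subset_span ⟨_, u, hu, j, rfl, rfl⟩) (Pi.single p 1)) k
    rwa [slice_adTY_tenB χ hτ (hX _ u hu), Submodule.smul_mem_iff _ hk] at this
  rcases y with g | y
  swap
  · rw [adjOp_eq_zero χ τ x (hX _ u hu), map_zero]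
    exact zero_mem _
  rcases x with h | x
  · by_cases hz : z = Sum.inl g
    · subst hz
      refine key (Sum.inl (g, Sum.inr ())) hu
        ⟨(Sum.inl (h, Sum.inr ()), Sum.inl (h, Sum.inr ())), rfl⟩ (Sum.inl (g, Sum.inr ())) ?_
      simp [adjK, leftScalar, antiIdx, circ₃_inl, shiftΩ]
    · have : gradeProj z (adjOp χ τ (Sum.inl h) u) = 0 := by
        rw [gradeProj_of_graded (y := Sum.inl g) _ z, if_neg (Ne.symm hz)]
        rintro (⟨g', s | s⟩ | i) hi
        · simp only [adjOp, PhTY]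
          split_ifs with h0
          · subst h0
            exact hX _ u hu _ hi
          · rfl
        · exact hX _ u hu _ hi
        · rfl
      rw [this]
      exact zero_mem _
  · rcases z with q | z
    · refine key (Sum.inl (g, Sum.inr ())) hu
        ⟨(Sum.inr (Sum.inr 0), Sum.inr (Sum.inr q)), rfl⟩ (Sum.inl (q, Sum.inl q)) ?_
      simp [adjK, leftScalar, antiIdx, circ₃_inr_inr, hτ, hχ]
    · have : gradeProj (Sum.inr z) (adjOp χ τ (Sum.inr x) u) = 0 := by
        funext i
        rcases i with i | i <;> simp [gradeProj_apply, tyGrade, adjOp, adjM]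
      rw [this]
      exact zero_mem _

end Invariance

end Proof

/-- a coideal of the Tambara–Yamagami WHA of the form
`I = Σ_{y ∈ Ω} X^y ⊗ conj(H^y)` is invariant iff `⊕_y X^y` is stable (as a set) under
all the operators `P^h` (`h ∈ G`) and `P^m`. -/
theorem TY_invariant_iff_P_stable (G : Type) [AddCommGroup G] [Fintype G] [DecidableEq G]
    (χ : G → G → ℂ) (τ : ℝ)
    (hχsymm : ∀ g h : G, χ g h = χ h g)
    (hχadd : ∀ g g' h : G, χ (g + g') h = χ g h * χ g' h)
    (hχnorm : ∀ g h : G, ‖χ g h‖ = 1)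
    (hχnondeg : ∀ g : G, (∀ h : G, χ g h = 1) → g = 0)
    (hτ : τ = (Real.sqrt (Fintype.card G))⁻¹ ∨ τ = -(Real.sqrt (Fintype.card G))⁻¹)
    (X : ΩIdx G → Submodule ℂ (TYV G))
    (hgraded : ∀ y : ΩIdx G, ∀ u ∈ X y, ∀ i : VIdx G, tyGrade G i ≠ y → u i = 0)
    (I : Submodule ℂ (TYB G))
    (hI : I = Submodule.span ℂ
      {b : TYB G | ∃ y : ΩIdx G, ∃ u ∈ X y, ∃ j : VIdx G, tyGrade G j = y ∧
        b = fun p : BIdx G => if p.1.2 = j then u p.1.1 else 0})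
    (hco : IsCoidealTY G χ τ I) :
    IsInvariantTY G χ τ I ↔
      ((∀ h : G, ((⨆ y : ΩIdx G, X y : Submodule ℂ (TYV G)) : Set (TYV G)) =
          PhTY G h '' ((⨆ y : ΩIdx G, X y : Submodule ℂ (TYV G)) : Set (TYV G))) ∧
        ((⨆ y : ΩIdx G, X y : Submodule ℂ (TYV G)) : Set (TYV G)) =
          PmTY G χ τ '' ((⨆ y : ΩIdx G, X y : Submodule ℂ (TYV G)) : Set (TYV G))) := by
  have hG : 0 < Real.sqrt (Fintype.card G) :=
    Real.sqrt_pos.mpr (by exact_mod_cast Fintype.card_pos)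
  have hτ0 : τ ≠ 0 := by
    rcases hτ with rfl | rfl
    · exact inv_ne_zero hG.ne'
    · exact neg_ne_zero.mpr (inv_ne_zero hG.ne')
  obtain rfl : I = tenSpan X := hI
  have hcmp := gradeProj_adjM_mem_iff hχadd hχnorm hτ0 hgraded hco.2.2.1
  have hmem := @mem_iSup_iff_gradeProj G _ _ _ X hgraded
  constructor
  · intro hinv
    have hs := le_suppV_of_isInvariantTY hτ0 hgraded hinv
    have hop := adjOp_mem_of_isInvariantTY hτ0 hgraded (chi_ne_zero hχnorm) hinv
    have hadj : ∀ x, ∀ u ∈ ⨆ y, X y, adjOp χ τ x u ∈ ⨆ y, X y := by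
      intro x u hu
      have : ⨆ y, X y ≤ (⨆ y, X y).comap (adjOpL χ τ x) :=
        iSup_le fun y u hu => hmem.mpr fun z => hop x y z hu
      exact this hu
    have hm : ∀ u ∈ ⨆ y, X y, PmTY G χ τ u ∈ ⨆ y, X y := fun u hu =>
      hmem.mpr ((hcmp u).mp (hmem.mp (hadj (Sum.inr ()) u hu)))
    refine ⟨fun h => Set.Subset.antisymm (fun u hu => ?_) ?_,
      Set.Subset.antisymm (fun u hu => ?_) ?_⟩
    · refine ⟨PhTY G (-h) u, hadj (Sum.inl (-h)) u hu, ?_⟩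
      rw [PhTY_PhTY, add_neg_cancel, PhTY_zero (hs hu)]
    · rintro _ ⟨u, hu, rfl⟩
      exact hadj (Sum.inl h) u hu
    · refine ⟨((Fintype.card G : ℂ) ^ 4)⁻¹ • PmTY G χ τ (PmTY G χ τ (PmTY G χ τ u)),
        Submodule.smul_mem _ _ (hm _ (hm _ (hm _ hu))), ?_⟩
      refine ((PmL χ τ).map_smul _ _).trans ?_
      change _ • PmTY G χ τ _ = _
      rw [PmTY_pow_four hχsymm hχadd hχnorm hχnondeg hτ0 (hs hu), inv_smul_smul₀]
      exact pow_ne_zero _ (by exact_mod_cast Fintype.card_ne_zero)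
    · rintro _ ⟨u, hu, rfl⟩
      exact hm u hu
  · rintro ⟨hPh, hPm⟩
    refine isInvariantTY_of_adjOp hτ0 hgraded (fun u hu => ?_) fun x y z u hu => ?_
    · rw [← SetLike.mem_coe, hPh 0] at hu
      obtain ⟨w, -, rfl⟩ := hu
      exact adjOp_mem_suppV χ τ (Sum.inl 0) w
    · have huW : u ∈ ⨆ y, X y := Submodule.mem_iSup_of_mem y hu
      rcases x with h | x
      · refine hmem.mp ?_ z
        rw [← SetLike.mem_coe, hPh h]
        exact ⟨u, huW, rfl⟩
      · refine (hcmp u).mpr (hmem.mp ?_) z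
        rw [← SetLike.mem_coe, hPm]
        exact ⟨u, huW, rfl⟩

end
end

section
/- Let 𝔊_TY = (B, Δ, S, ε) be the Tambara–Yamagami weak Hopf *-algebra attached to (G, χ, τ). Then every invariant coideal I of 𝔊_TY of the form I = ⊕_{y∈Ω} X^y ⊗ conj(H^y), with subspaces X^y ⊆ H^y, equals I^x for exactly one x ∈ Subgrp(G) ⊔ {Ω}, where for a subgroup L ≤ G, I^L := span{ v^0_Y : Y ∈ G/L } ⊗ conj(H^0) + Σ_{l∈L^⊥} ℂ v^l_m ⊗ conj(H^l) (with v^0_Y := Σ_{y∈Y} v^0_y and L^⊥ := {g : χ(g,l)=1 ∀l∈L}) and I^Ω := B_s = ε_s(B). -/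
open scoped TensorProduct

noncomputable section

open scoped Classical

section Helpers

set_option linter.unusedSectionVars false

variable {G : Type} [AddCommGroup G] [Fintype G] [DecidableEq G]

/-- The left support of a basis vector: the `γ ∈ Ω` with `v^0_γ ∘ v = v`. -/
def lsupp : VIdx G → ΩIdx G
  | Sum.inl (g, a) => shiftΩ G a g
  | Sum.inr (Sum.inl k) => Sum.inl k
  | Sum.inr (Sum.inr _) => Sum.inr ()

/-- The right support of a basis vector: the `γ ∈ Ω` with `v ∘ v^0_γ = v`. -/
def rsupp : VIdx G → ΩIdx G
  | Sum.inl (_, a) => a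
  | Sum.inr (Sum.inl _) => Sum.inr ()
  | Sum.inr (Sum.inr k) => Sum.inl k

/-- The index of `f^g_{a,b}`. -/
def idxG (g : G) (a b : ΩIdx G) : BIdx G := ⟨(Sum.inl (g, a), Sum.inl (g, b)), rfl⟩

/-- The index of `f^m_{α,β}`. -/
def idxM (α β : MIdx G) : BIdx G := ⟨(Sum.inr α, Sum.inr β), rfl⟩

theorem idxM_inj {α β γ δ : MIdx G} : idxM α β = idxM γ δ ↔ α = γ ∧ β = δ := by
  rw [idxM, idxM, Subtype.ext_iff]
  simp

/-- The element `u ⊗ conj (v_j)` of `B`. -/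
def colTY (u : TYV G) (j : VIdx G) : TYB G := fun p => if p.1.2 = j then u p.1.1 else 0

/-- The component in `V` of an element of `B` along `conj (v_j)`. -/
def colMap (j : VIdx G) : TYB G →ₗ[ℂ] TYV G where
  toFun b := fun i => if h : tyGrade G i = tyGrade G j then b ⟨(i, j), h⟩ else 0
  map_add' a b := by ext i; by_cases h : tyGrade G i = tyGrade G j <;> simp [h]
  map_smul' c b := by ext i; by_cases h : tyGrade G i = tyGrade G j <;> simp [h]

theorem colMap_apply_of_grade {i j : VIdx G} (h : tyGrade G i = tyGrade G j) (b : TYB G) :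
    colMap j b i = b ⟨(i, j), h⟩ := by simp [colMap, h]

theorem colMap_apply_of_ne {i j : VIdx G} (h : tyGrade G i ≠ tyGrade G j) (b : TYB G) :
    colMap j b i = 0 := by simp [colMap, h]

theorem supp_of_circC_ne_zero {χ : G → G → ℂ} {τ : ℝ} {a b c : VIdx G}
    (h : circC G χ τ a b c ≠ 0) : lsupp c = lsupp a ∧ rsupp c = rsupp b := by
  rcases a with ⟨g, k | u⟩ | k | k <;> rcases b with ⟨g', k' | u'⟩ | k' | k' <;>
    rcases c with ⟨g'', k'' | u''⟩ | k'' | k'' <;>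
    (simp_all [circC, lsupp, rsupp, shiftΩ]; try grind)

theorem lsupp_of_SCoef_ne_zero {τ : ℝ} {q s : BIdx G} (h : SCoef G τ q s ≠ 0) :
    lsupp s.1.1 = rsupp q.1.2 := by
  obtain ⟨⟨⟨g, a⟩ | k | k, ⟨g', a'⟩ | k' | k'⟩, hq⟩ := q <;>
    obtain ⟨⟨⟨g₂, a₂⟩ | k₂ | k₂, ⟨g₂', a₂'⟩ | k₂' | k₂'⟩, hs⟩ := s <;>
    simp_all [SCoef, lsupp, rsupp]
  obtain ⟨⟨rfl, _⟩, rfl, _⟩ := h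
  rcases a' with a' | a' <;> simp [shiftΩ]

theorem STY_single (τ : ℝ) (q : BIdx G) : STY G τ (Pi.single q 1) = SCoef G τ q := by
  ext r
  rw [STY, Finset.sum_eq_single q (by intro p _ hp; simp [hp]) (by simp)]
  simp

theorem mulTY_single_right (χ : G → G → ℂ) (τ : ℝ) (f : TYB G) (q r : BIdx G) :
    mulTY G χ τ f (Pi.single q 1) r =
      ∑ p, f p * circC G χ τ p.1.1 q.1.1 r.1.1 * star (circC G χ τ p.1.2 q.1.2 r.1.2) := by
  rw [mulTY]
  refine Finset.sum_congr rfl fun p _ => ?_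
  rw [Finset.sum_eq_single q (by intro p _ hp; simp [hp]) (by simp)]
  simp

theorem mulTY_single_left (χ : G → G → ℂ) (τ : ℝ) (f : TYB G) (q r : BIdx G) :
    mulTY G χ τ (Pi.single q 1) f r =
      ∑ p, f p * circC G χ τ q.1.1 p.1.1 r.1.1 * star (circC G χ τ q.1.2 p.1.2 r.1.2) := by
  rw [mulTY, Finset.sum_eq_single q (by intro p _ hp; simp [hp]) (by simp)]
  simp

theorem mulTY_single_single (χ : G → G → ℂ) (τ : ℝ) (p q r : BIdx G) :
    mulTY G χ τ (Pi.single p 1) (Pi.single q 1) r =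
      circC G χ τ p.1.1 q.1.1 r.1.1 * star (circC G χ τ p.1.2 q.1.2 r.1.2) := by
  rw [mulTY_single_right, Finset.sum_eq_single p (by intro p _ hp; simp [hp]) (by simp)]
  simp

theorem mulTY_smul_left (χ : G → G → ℂ) (τ : ℝ) (c : ℂ) (f f' : TYB G) :
    mulTY G χ τ (c • f) f' = c • mulTY G χ τ f f' := by
  ext r
  simp [mulTY, Finset.mul_sum, mul_assoc]

theorem mulTY_zero_left (χ : G → G → ℂ) (τ : ℝ) (f' : TYB G) :
    mulTY G χ τ 0 f' = 0 := by
  ext r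
  simp [mulTY]

theorem adTY_apply_eq_zero (χ : G → G → ℂ) (τ : ℝ) (a x : TYB G) {r : BIdx G}
    (hr : lsupp r.1.1 ≠ rsupp r.1.1) : adTY G χ τ a x r = 0 := by
  simp only [adTY, Finset.sum_apply, Pi.smul_apply, smul_eq_mul]
  refine Finset.sum_eq_zero fun p _ => Finset.sum_eq_zero fun q₁ _ =>
    Finset.sum_eq_zero fun q₂ _ => ?_
  by_cases hq : q₁.1.2 = q₂.1.1
  · refine mul_eq_zero_of_right _ ?_
    rw [mulTY_single_right]
    refine Finset.sum_eq_zero fun s _ => ?_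
    by_contra hne
    have h₁ : mulTY G χ τ (STY G τ (Pi.single q₁ 1)) a s ≠ 0 := fun h => hne (by simp [h])
    have h₂ : circC G χ τ s.1.1 q₂.1.1 r.1.1 ≠ 0 := fun h => hne (by simp [h])
    obtain ⟨t, _, ht⟩ := Finset.exists_ne_zero_of_sum_ne_zero h₁
    obtain ⟨t', _, ht'⟩ := Finset.exists_ne_zero_of_sum_ne_zero ht
    rw [STY_single] at ht'
    have h₃ : SCoef G τ q₁ t ≠ 0 := fun h => ht' (by simp [h])
    have h₄ : circC G χ τ t.1.1 t'.1.1 s.1.1 ≠ 0 := fun h => ht' (by simp [h])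
    refine hr ?_
    rw [(supp_of_circC_ne_zero h₂).1, (supp_of_circC_ne_zero h₂).2,
      (supp_of_circC_ne_zero h₄).1, lsupp_of_SCoef_ne_zero h₃, hq]
  · simp [Δc, hq]

theorem adTY_single_idxM (χ : G → G → ℂ) (τ : ℝ) (a : TYB G) (α β : MIdx G) :
    adTY G χ τ a (Pi.single (idxM α β) 1) = ∑ γ : MIdx G,
      mulTY G χ τ (mulTY G χ τ (STY G τ (Pi.single (idxM α γ) 1)) a)
        (Pi.single (idxM γ β) 1) := by
  have inj₁ : Function.Injective (idxM (G := G) α) := fun x y h =>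
    (idxM_inj.1 h).2
  have inj₂ : Function.Injective fun γ => idxM (G := G) γ β := fun x y h =>
    (idxM_inj.1 h).1
  unfold adTY
  rw [Finset.sum_eq_single (idxM α β) (by intro p _ hp; simp [hp]) (by simp)]
  symm
  refine Finset.sum_of_injOn (idxM α) inj₁.injOn (by simp) ?_ ?_
  · rintro ⟨⟨i, j⟩, h⟩ _ hn
    refine Finset.sum_eq_zero fun q₂ _ => ?_
    rw [Δc, if_neg, mul_zero, zero_smul]
    rintro ⟨h1, -, -⟩
    simp only [idxM] at h1
    subst h1
    rcases j with ⟨g, j⟩ | j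
    · simp [tyGrade] at h
    · exact hn ⟨j, by simp, rfl⟩
  · intro γ _
    rw [Finset.sum_eq_single (idxM γ β)]
    · simp [Δc, idxM]
    · rintro ⟨⟨i, j⟩, h⟩ _ hn
      rw [Δc, if_neg, mul_zero, zero_smul]
      rintro ⟨-, h1, h2⟩
      simp only [idxM] at h1 h2
      subst h1 h2
      exact hn rfl
    · simp

theorem STY_single_idxM (τ : ℝ) (α β : MIdx G) : STY G τ (Pi.single (idxM α β) 1) =
    (match α, β with
      | Sum.inl _, Sum.inr _ => (τ : ℂ)⁻¹
      | Sum.inr _, Sum.inl _ => (τ : ℂ)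
      | _, _ => 1 : ℂ) • Pi.single (idxM β.swap α.swap) 1 := by
  rw [STY_single]
  ext ⟨⟨⟨g, a⟩ | γ, ⟨g', a'⟩ | δ⟩, h⟩
  · rw [Pi.smul_apply, Pi.single_apply, if_neg (by simp [idxM, Subtype.ext_iff])]
    simp [SCoef, idxM]
  · simp [tyGrade] at h
  · simp [tyGrade] at h
  · change SCoef G τ (idxM α β) (idxM γ δ) = (_ • Pi.single _ _ : TYB G) (idxM γ δ)
    rw [Pi.smul_apply, Pi.single_apply]
    simp only [idxM_inj]
    simp [SCoef, idxM]

theorem mulTY_idxM_bar_colTY (χ : G → G → ℂ) (τ : ℝ) (u : TYV G) (k h : G) :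
    mulTY G χ τ (Pi.single (idxM (Sum.inr k) (Sum.inr h)) 1)
        (colTY u (Sum.inl (0, Sum.inl h))) =
      u (Sum.inl (0, Sum.inl k)) • Pi.single (idxM (Sum.inr k) (Sum.inr h)) 1 := by
  ext r
  rw [mulTY_single_left, Finset.sum_eq_single (idxG 0 (Sum.inl k) (Sum.inl h))]
  · obtain ⟨⟨r₁, r₂⟩, hr⟩ := r
    simp only [Pi.smul_apply, Pi.single_apply, colTY, idxG, idxM, Subtype.ext_iff, Prod.mk.injEq]
    by_cases h₁ : r₁ = Sum.inr (Sum.inr k) <;> by_cases h₂ : r₂ = Sum.inr (Sum.inr h) <;>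
      simp [circC, h₁, h₂]
  · rintro ⟨⟨i, j⟩, hij⟩ _ hne
    by_cases hj : j = Sum.inl (0, Sum.inl h)
    · subst hj
      rcases i with ⟨g, x⟩ | i
      · obtain rfl : g = 0 := by simpa [tyGrade] using hij
        have : x ≠ Sum.inl k := by rintro rfl; exact hne rfl
        simp [circC, idxM, this]
      · simp [tyGrade] at hij
    · simp [colTY, hj]
  · simp

theorem mulTY_idxM_unbar_colTY {χ : G → G → ℂ} (hχ : ∀ h, χ 0 h = 1) (τ : ℝ) (u : TYV G)
    (k h : G) :
    mulTY G χ τ (Pi.single (idxM (Sum.inl k) (Sum.inr h)) 1)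
        (colTY u (Sum.inl (0, Sum.inl h))) =
      u (Sum.inl (0, Sum.inr ())) • Pi.single (idxM (Sum.inl k) (Sum.inr h)) 1 := by
  ext r
  rw [mulTY_single_left, Finset.sum_eq_single (idxG 0 (Sum.inr ()) (Sum.inl h))]
  · obtain ⟨⟨r₁, r₂⟩, hr⟩ := r
    simp only [Pi.smul_apply, Pi.single_apply, colTY, idxG, idxM, Subtype.ext_iff, Prod.mk.injEq]
    by_cases h₁ : r₁ = Sum.inr (Sum.inl k) <;> by_cases h₂ : r₂ = Sum.inr (Sum.inr h) <;>
      simp [circC, h₁, h₂, hχ]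
  · rintro ⟨⟨i, j⟩, hij⟩ _ hne
    by_cases hj : j = Sum.inl (0, Sum.inl h)
    · subst hj
      rcases i with ⟨g, x⟩ | i
      · obtain rfl : g = 0 := by simpa [tyGrade] using hij
        have : x ≠ Sum.inr () := by rintro rfl; exact hne rfl
        simp [circC, idxM, this]
      · simp [tyGrade] at hij
    · simp [colTY, hj]
  · simp

theorem adTY_colTY_apply {χ : G → G → ℂ} (hχ : ∀ h, χ 0 h = 1) (hχ' : ∀ h, χ h 0 = 1)
    (τ : ℝ) (u : TYV G) (g : G) :
    adTY G χ τ (colTY u (Sum.inl (0, Sum.inl 0)))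
        (Pi.single (idxM (Sum.inl 0) (Sum.inl 0)) 1) (idxG g (Sum.inr ()) (Sum.inr ())) =
      (τ : ℂ) ^ 2 * ∑ k, u (Sum.inl (0, Sum.inl k)) * (χ g k)⁻¹ := by
  rw [adTY_single_idxM, Fintype.sum_sum_type, Pi.add_apply, Finset.sum_apply, Finset.sum_apply,
    Finset.mul_sum]
  refine (congrArg₂ (· + ·) ?_ (Finset.sum_eq_zero ?_)).trans (add_zero _)
  · refine Finset.sum_congr rfl fun k _ => ?_
    simp only [STY_single_idxM, Sum.swap_inl, one_smul, mulTY_idxM_bar_colTY, mulTY_smul_left,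
      Pi.smul_apply, mulTY_single_single, smul_eq_mul]
    simp [idxM, idxG, circC, hχ']
    ring
  · intro k _
    simp only [STY_single_idxM, Sum.swap_inl, Sum.swap_inr, mulTY_idxM_unbar_colTY hχ,
      mulTY_smul_left, Pi.smul_apply, mulTY_single_single, smul_eq_mul]
    simp [idxM, idxG, circC]

theorem mulTY_idxM_idxG_unbar {χ : G → G → ℂ} (hχ' : ∀ h, χ h 0 = 1) (τ : ℝ) (g k : G) :
    mulTY G χ τ (Pi.single (idxM (Sum.inl k) (Sum.inl 0)) 1)
        (Pi.single (idxG g (Sum.inr ()) (Sum.inr ())) 1) =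
      χ g k • Pi.single (idxM (Sum.inl k) (Sum.inl 0)) 1 := by
  ext ⟨⟨r₁, r₂⟩, hr⟩
  rw [mulTY_single_single]
  simp only [Pi.smul_apply, Pi.single_apply, idxG, idxM, Subtype.ext_iff, Prod.mk.injEq]
  by_cases h₁ : r₁ = Sum.inr (Sum.inl k) <;> by_cases h₂ : r₂ = Sum.inr (Sum.inl 0) <;>
    simp [circC, h₁, h₂, hχ']

theorem mulTY_idxM_idxG_bar (χ : G → G → ℂ) (τ : ℝ) (g k : G) :
    mulTY G χ τ (Pi.single (idxM (Sum.inr k) (Sum.inl 0)) 1)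
        (Pi.single (idxG g (Sum.inr ()) (Sum.inr ())) 1) = 0 := by
  ext r
  rw [mulTY_single_single]
  simp [idxG, idxM, circC]

theorem adTY_idxG_apply {χ : G → G → ℂ} (hχ' : ∀ h, χ h 0 = 1) (τ : ℝ) (g : G) (a : ΩIdx G) :
    adTY G χ τ (Pi.single (idxG g (Sum.inr ()) (Sum.inr ())) 1)
        (Pi.single (idxM (Sum.inr 0) (Sum.inr 0)) 1) (idxG 0 a (Sum.inl 0)) =
      Sum.elim (χ g) 0 a := by
  rw [adTY_single_idxM, Fintype.sum_sum_type, Pi.add_apply, Finset.sum_apply, Finset.sum_apply,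
    Finset.sum_eq_zero (s := Finset.univ (α := G)) (f := fun k => _), zero_add]
  · rcases a with a | a
    · rw [Finset.sum_eq_single a]
      · simp only [STY_single_idxM, Sum.swap_inr, one_smul, mulTY_idxM_idxG_unbar hχ',
          mulTY_smul_left, Pi.smul_apply, mulTY_single_single]
        simp [idxM, idxG, circC]
      · intro k _ hk
        simp only [STY_single_idxM, Sum.swap_inr, one_smul, mulTY_idxM_idxG_unbar hχ',
          mulTY_smul_left, Pi.smul_apply, mulTY_single_single]
        simp [idxM, idxG, circC, hk.symm]
      · simp
    · refine Finset.sum_eq_zero fun k _ => ?_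
      simp only [STY_single_idxM, Sum.swap_inr, one_smul, mulTY_idxM_idxG_unbar hχ',
        mulTY_smul_left, Pi.smul_apply, mulTY_single_single]
      simp [idxM, idxG, circC]
  · intro k _
    simp only [STY_single_idxM, Sum.swap_inl, Sum.swap_inr, mulTY_idxM_idxG_bar,
      mulTY_smul_left, mulTY_zero_left, smul_zero, Pi.zero_apply]

theorem mulTY_idxG_idxG (χ : G → G → ℂ) (τ : ℝ) (g h : G) :
    mulTY G χ τ (Pi.single (idxG g (Sum.inr ()) (Sum.inr ())) 1)
        (Pi.single (idxG h (Sum.inr ()) (Sum.inr ())) 1) =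
      Pi.single (idxG (g + h) (Sum.inr ()) (Sum.inr ())) 1 := by
  ext ⟨⟨r₁, r₂⟩, hr⟩
  rw [mulTY_single_single]
  simp only [Pi.single_apply, idxG, Subtype.ext_iff, Prod.mk.injEq]
  by_cases h₁ : r₁ = Sum.inl (g + h, Sum.inr ()) <;>
    by_cases h₂ : r₂ = Sum.inl (g + h, Sum.inr ()) <;> simp [circC, h₁, h₂]

theorem colTY_single (i j : VIdx G) (h : tyGrade G i = tyGrade G j) :
    colTY (Pi.single i 1) j = Pi.single ⟨(i, j), h⟩ 1 := by
  ext ⟨⟨i', j'⟩, h'⟩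
  simp only [colTY, Pi.single_apply, Subtype.ext_iff, Prod.mk.injEq]
  split_ifs <;> simp_all

theorem bM_eq_colTY (l : G) (w : ΩIdx G) :
    bM G l w = colTY (Pi.single (Sum.inl (l, Sum.inr ())) 1) (Sum.inl (l, w)) := by
  ext ⟨⟨⟨g, a | a⟩ | i, ⟨g', a'⟩ | i'⟩, h⟩ <;> simp [bM, colTY, Pi.single_apply]
  split_ifs <;> simp_all

/-- The vector `Σ_y φ(y) v^0_y + c v^0_m` of `H^0`. -/
def vecZero (φ : G → ℂ) (c : ℂ) : TYV G
  | Sum.inl (g, Sum.inl y) => if g = 0 then φ y else 0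
  | Sum.inl (g, Sum.inr _) => if g = 0 then c else 0
  | Sum.inr _ => 0

theorem bCoset_eq_colTY (Y : Set G) (w : ΩIdx G) :
    bCoset G Y w = colTY (vecZero (Y.indicator 1) 0) (Sum.inl (0, w)) := by
  ext ⟨⟨⟨g, a | a⟩ | i, ⟨g', a'⟩ | i'⟩, h⟩ <;>
    simp [bCoset, colTY, vecZero, Set.indicator_apply]
  split_ifs <;> simp_all

theorem oneTY_apply (p : BIdx G) :
    oneTY G p = if tyGrade G p.1.1 = Sum.inl 0 then 1 else 0 := by
  obtain ⟨⟨⟨g, a⟩ | i, j⟩, h⟩ := p <;> simp [oneTY, tyGrade]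

theorem vecZero_one_apply (i : VIdx G) :
    vecZero 1 1 i = if tyGrade G i = Sum.inl 0 then 1 else 0 := by
  rcases i with ⟨g, a | a⟩ | i <;> simp [vecZero, tyGrade]

theorem ΔTY_oneTY_apply (s r : BIdx G) : ΔTY G (oneTY G) (s, r) =
    if tyGrade G s.1.1 = Sum.inl 0 ∧ s.1.2 = r.1.1 then 1 else 0 := by
  rw [ΔTY]
  by_cases h : s.1.2 = r.1.1
  · rw [Finset.sum_eq_single ⟨(s.1.1, r.1.2), by rw [s.2, h, r.2]⟩]
    · simp [Δc, h, oneTY_apply]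
    · intro p _ hp
      rw [Δc, if_neg, mul_zero]
      rintro ⟨h₁, h₂, -⟩
      exact hp (Subtype.ext (Prod.ext h₁.symm h₂.symm))
    · simp
  · simp [Δc, h]

theorem mulTY_idxG_zero (χ : G → G → ℂ) (τ : ℝ) (w w' a : ΩIdx G) :
    mulTY G χ τ (Pi.single (idxG 0 w w) 1) (Pi.single (idxG 0 w' a) 1) =
      if w' = w ∧ a = w then Pi.single (idxG 0 w w) 1 else 0 := by
  ext ⟨⟨r₁, r₂⟩, hr⟩
  rw [mulTY_single_single]
  rcases w with k | u
  · by_cases h₁ : r₁ = Sum.inl (0, Sum.inl k) <;> by_cases h₂ : r₂ = Sum.inl (0, Sum.inl k) <;>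
      by_cases h₃ : w' = Sum.inl k <;> by_cases h₄ : a = Sum.inl k <;>
      simp [circC, idxG, h₁, h₂, h₃, h₄, Pi.single_apply, Subtype.ext_iff]
  · by_cases h₁ : r₁ = Sum.inl (0, Sum.inr ()) <;> by_cases h₂ : r₂ = Sum.inl (0, Sum.inr ()) <;>
      by_cases h₃ : w' = Sum.inr () <;> by_cases h₄ : a = Sum.inr () <;>
      simp [circC, idxG, h₁, h₂, h₃, h₄, Pi.single_apply, Subtype.ext_iff]

/-- The coefficients of `ε_s(b)` in the basis `v^0_Ω ⊗ conj (v^0_w)` of `B_s`. -/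
def sourceCoef (χ : G → G → ℂ) (τ : ℝ) (b : TYB G) (j : VIdx G) : ℂ :=
  ∑ r : BIdx G, if j = r.1.1 then εTY G (mulTY G χ τ b (Pi.single r 1)) else 0

theorem εsTY_eq_sum (χ : G → G → ℂ) (τ : ℝ) (b : TYB G) :
    εsTY G χ τ b = ∑ w : ΩIdx G,
      sourceCoef χ τ b (Sum.inl (0, w)) • colTY (vecZero 1 1) (Sum.inl (0, w)) := by
  ext ⟨⟨i, j⟩, h⟩
  have key : εsTY G χ τ b ⟨(i, j), h⟩ =
      if tyGrade G i = Sum.inl 0 then sourceCoef χ τ b j else 0 := by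
    simp only [εsTY, ΔTY_oneTY_apply, sourceCoef]
    by_cases hi : tyGrade G i = Sum.inl 0 <;> simp [hi]
  rw [key, Finset.sum_apply]
  rcases j with ⟨g, a⟩ | j
  · by_cases hg : g = 0
    · subst hg
      rw [Finset.sum_eq_single a]
      · simp [colTY, vecZero_one_apply]
      · intro w _ hw
        simp [colTY, hw.symm]
      · simp
    · have : tyGrade G i ≠ Sum.inl 0 := by rw [h]; simpa [tyGrade] using hg
      simp [this, colTY, hg]
  · have : tyGrade G i ≠ Sum.inl 0 := by rw [h]; simp [tyGrade]
    simp [this, colTY]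

theorem sourceCoef_single (χ : G → G → ℂ) (τ : ℝ) (w w' : ΩIdx G) :
    sourceCoef χ τ (Pi.single (idxG 0 w w) 1) (Sum.inl (0, w')) = if w' = w then 1 else 0 := by
  have aux : ∀ a, εTY G (mulTY G χ τ (Pi.single (idxG 0 w w) 1) (Pi.single (idxG 0 w' a) 1)) =
      if w' = w ∧ a = w then 1 else 0 := by
    intro a
    rw [mulTY_idxG_zero]
    split_ifs
    · rw [εTY, Finset.sum_eq_single (idxG 0 w w) (by intro p _ hp; simp [hp]) (by simp)]
      simp [idxG]
    · simp [εTY]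
  rw [sourceCoef, Finset.sum_eq_single (idxG 0 w' w)]
  · rw [aux]; simp [idxG]
  · rintro ⟨⟨i, j⟩, h⟩ _ hne
    by_cases hi : Sum.inl (0, w') = i
    · subst hi
      rcases j with ⟨g, a⟩ | j
      · obtain rfl : 0 = g := by simpa [tyGrade] using h
        have ha : a ≠ w := by rintro rfl; exact hne rfl
        exact (if_pos rfl).trans ((aux a).trans (by simp [ha]))
      · simp [tyGrade] at h
    · simp [hi]
  · simp

theorem BsTY_eq_span (χ : G → G → ℂ) (τ : ℝ) : BsTY G χ τ =
    Submodule.span ℂ (Set.range fun w : ΩIdx G => colTY (vecZero 1 1) (Sum.inl (0, w))) := by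
  apply le_antisymm <;> rw [BsTY, Submodule.span_le]
  · rintro _ ⟨b, rfl⟩
    rw [εsTY_eq_sum]
    exact Submodule.sum_mem _ fun w _ => Submodule.smul_mem _ _ (Submodule.subset_span ⟨w, rfl⟩)
  · rintro _ ⟨w, rfl⟩
    refine Submodule.subset_span ⟨Pi.single (idxG 0 w w) 1, ?_⟩
    simp only [εsTY_eq_sum, sourceCoef_single, ite_smul, one_smul, zero_smul]
    simp

theorem bichar_zero_left {χ : G → G → ℂ} (hadd : ∀ g g' h, χ (g + g') h = χ g h * χ g' h)
    (hne : ∀ g h, χ g h ≠ 0) (h : G) : χ 0 h = 1 := by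
  have := hadd 0 0 h
  rw [add_zero] at this
  exact (mul_eq_left₀ (hne 0 h)).1 this.symm

theorem bichar_neg_left {χ : G → G → ℂ} (hadd : ∀ g g' h, χ (g + g') h = χ g h * χ g' h)
    (hne : ∀ g h, χ g h ≠ 0) (g h : G) : χ (-g) h = (χ g h)⁻¹ := by
  refine eq_inv_of_mul_eq_one_left ?_
  rw [← hadd, neg_add_cancel, bichar_zero_left hadd hne]

theorem sum_addSubgroup_bichar {χ : G → G → ℂ}
    (hadd : ∀ g g' h, χ (g + g') h = χ g h * χ g' h) (K : AddSubgroup G) (y : G) :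
    ∑ s : K, χ s y = if ∀ s ∈ K, χ s y = 1 then (Fintype.card K : ℂ) else 0 := by
  split_ifs with h
  · simp [h]
  · push Not at h
    obtain ⟨s, hs, hne⟩ := h
    have key : χ s y * ∑ t : K, χ t y = ∑ t : K, χ t y := by
      rw [Finset.mul_sum, ← Equiv.sum_comp (Equiv.addLeft (⟨s, hs⟩ : K)) fun t : K => χ t y]
      simp [hadd]
    by_contra h0
    exact hne ((mul_eq_right₀ h0).1 key)

theorem sum_bichar {χ : G → G → ℂ} (hsymm : ∀ g h, χ g h = χ h g)
    (hadd : ∀ g g' h, χ (g + g') h = χ g h * χ g' h)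
    (hne : ∀ g h, χ g h ≠ 0)
    (hnondeg : ∀ g : G, (∀ h : G, χ g h = 1) → g = 0) (y : G) :
    ∑ s, χ s y = if y = 0 then (Fintype.card G : ℂ) else 0 := by
  have hy : (∀ s ∈ (⊤ : AddSubgroup G), χ s y = 1) ↔ y = 0 := by
    constructor
    · exact fun h => hnondeg y fun s => by rw [hsymm, h s trivial]
    · rintro rfl s -
      rw [hsymm, bichar_zero_left hadd hne]
  have h := sum_addSubgroup_bichar hadd ⊤ y
  rw [Fintype.card_congr AddSubgroup.topEquiv.toEquiv] at h
  rw [← Equiv.sum_comp AddSubgroup.topEquiv.toEquiv fun s => χ s y]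
  simp only [hy] at h
  exact h

theorem exists_addSubgroup_of_add_mem {S : Set G} (hne : S.Nonempty)
    (hadd : ∀ g ∈ S, ∀ h ∈ S, g + h ∈ S) : ∃ K : AddSubgroup G, (K : Set G) = S := by
  have hnsmul : ∀ g ∈ S, ∀ n : ℕ, (n + 1) • g ∈ S := by
    intro g hg n
    induction n with
    | zero => simpa using hg
    | succ n ih => rw [succ_nsmul]; exact hadd _ ih _ hg
  have hpos : 0 < Fintype.card G := Fintype.card_pos
  have hzero : (0 : G) ∈ S := by
    obtain ⟨g, hg⟩ := hne
    have := hnsmul g hg (Fintype.card G - 1)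
    rwa [Nat.sub_add_cancel hpos, card_nsmul_eq_zero] at this
  refine ⟨{ carrier := S, add_mem' := fun {a b} ha hb => hadd a ha b hb, zero_mem' := hzero,
            neg_mem' := ?_ }, rfl⟩
  intro g hg
  have h₁ : -g = (Fintype.card G - 1) • g := by
    rw [neg_eq_iff_add_eq_zero, ← succ_nsmul', Nat.sub_add_cancel hpos, card_nsmul_eq_zero]
  rw [h₁]
  rcases h₂ : Fintype.card G - 1 with _ | n
  · simpa using hzero
  · exact hnsmul g hg n

theorem fourier_inversion {χ : G → G → ℂ} (hsymm : ∀ g h, χ g h = χ h g)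
    (hadd : ∀ g g' h, χ (g + g') h = χ g h * χ g' h) (hne : ∀ g h, χ g h ≠ 0)
    (hnondeg : ∀ g : G, (∀ h : G, χ g h = 1) → g = 0) (φ : G → ℂ) (x : G) :
    ∑ g, (∑ k, φ k * (χ g k)⁻¹) * χ g x = Fintype.card G * φ x := by
  have h : ∀ g k, φ k * (χ g k)⁻¹ * χ g x = φ k * χ g (x - k) := fun g k => by
    rw [hsymm g (x - k), sub_eq_add_neg, hadd, bichar_neg_left hadd hne, hsymm k g, hsymm x g]
    ring
  simp_rw [Finset.sum_mul, h]
  rw [Finset.sum_comm]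
  simp_rw [← Finset.mul_sum, sum_bichar hsymm hadd hne hnondeg]
  rw [Finset.sum_eq_single x]
  · simp [mul_comm]
  · intro k _ hk
    simp [sub_eq_zero, hk.symm]
  · simp

theorem ILTY_apply_eq {χ : G → G → ℂ} {L : AddSubgroup G} {b : TYB G} (hb : b ∈ ILTY G χ L)
    {x y : G} (hxy : x - y ∈ L) (w : ΩIdx G) :
    b (idxG 0 (Sum.inl x) w) = b (idxG 0 (Sum.inl y) w) := by
  induction hb using Submodule.span_induction with
  | mem b hb =>
    rcases hb with ⟨g, w', rfl⟩ | ⟨l, -, w', rfl⟩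
    · have : x - g ∈ L ↔ y - g ∈ L := by
        rw [← sub_add_sub_cancel x y g, AddSubgroup.add_mem_cancel_left L hxy]
      simp [bCoset, idxG, this]
    · simp [bM, idxG]
  | zero => rfl
  | add a b _ _ ha hb => simp [ha, hb]
  | smul c b _ hb => simp [hb]

theorem ILTY_le_of_le {χ : G → G → ℂ} {L L' : AddSubgroup G} (h : ILTY G χ L ≤ ILTY G χ L') :
    L' ≤ L := by
  intro l hl
  have hmem : bCoset G {x : G | x - 0 ∈ L} (Sum.inr ()) ∈ ILTY G χ L :=
    Submodule.subset_span (Or.inl ⟨0, _, rfl⟩)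
  have := ILTY_apply_eq (h hmem) (x := l) (y := 0) (by simpa using hl) (Sum.inr ())
  simpa [bCoset, idxG] using this

theorem ILTY_injective (χ : G → G → ℂ) : Function.Injective (ILTY G χ) := fun _ _ h =>
  le_antisymm (ILTY_le_of_le h.ge) (ILTY_le_of_le h.le)

theorem ILTY_ne_BsTY {χ : G → G → ℂ} (hχ : ∀ h, χ 0 h = 1) (τ : ℝ) (L : AddSubgroup G) :
    ILTY G χ L ≠ BsTY G χ τ := by
  intro h
  have hmem : bM G 0 (Sum.inr ()) ∈ BsTY G χ τ :=
    h ▸ Submodule.subset_span (Or.inr ⟨0, fun l _ => hχ l, _, rfl⟩)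
  have key : ∀ b ∈ BsTY G χ τ, b (idxG 0 (Sum.inr ()) (Sum.inr ())) =
      b (idxG 0 (Sum.inl 0) (Sum.inr ())) := by
    intro b hb
    rw [BsTY_eq_span] at hb
    induction hb using Submodule.span_induction with
    | mem b hb => obtain ⟨w, rfl⟩ := hb; simp [colTY, idxG, vecZero]
    | zero => rfl
    | add a b _ _ ha hb => simp [ha, hb]
    | smul c b _ hb => simp [hb]
  simpa [bM, idxG] using key _ hmem
section Columns

variable {I : Submodule ℂ (TYB G)} {X : ΩIdx G → Submodule ℂ (TYV G)}

theorem colTY_mem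
    (hI : I = Submodule.span ℂ
      {b : TYB G | ∃ y : ΩIdx G, ∃ u ∈ X y, ∃ j : VIdx G, tyGrade G j = y ∧ b = colTY u j})
    {u : TYV G} {j : VIdx G} (hu : u ∈ X (tyGrade G j)) : colTY u j ∈ I :=
  hI ▸ Submodule.subset_span ⟨_, u, hu, j, rfl, rfl⟩

theorem colMap_mem (hsupp : ∀ y : ΩIdx G, ∀ u ∈ X y, ∀ i : VIdx G, tyGrade G i ≠ y → u i = 0)
    (hI : I = Submodule.span ℂ
      {b : TYB G | ∃ y : ΩIdx G, ∃ u ∈ X y, ∃ j : VIdx G, tyGrade G j = y ∧ b = colTY u j})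
    {b : TYB G} (hb : b ∈ I) {j : VIdx G} {y : ΩIdx G} (hj : tyGrade G j = y) :
    colMap j b ∈ X y := by
  subst hj
  suffices h : I ≤ (X (tyGrade G j)).comap (colMap j) from h hb
  rw [hI, Submodule.span_le]
  rintro _ ⟨_, u, hu, j', rfl, rfl⟩
  rw [SetLike.mem_coe, Submodule.mem_comap]
  by_cases hj : j = j'
  · subst hj
    convert hu using 1
    ext i
    by_cases hi : tyGrade G i = tyGrade G j
    · rw [colMap_apply_of_grade hi, colTY, if_pos rfl]
    · rw [colMap_apply_of_ne hi, hsupp _ u hu i hi]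
  · convert Submodule.zero_mem _ using 1
    ext i
    by_cases hi : tyGrade G i = tyGrade G j
    · rw [colMap_apply_of_grade hi, colTY, if_neg hj, Pi.zero_apply]
    · rw [colMap_apply_of_ne hi, Pi.zero_apply]

end Columns

theorem apply_eq_zero_of_isInvariantTY {χ : G → G → ℂ} {τ : ℝ} {I : Submodule ℂ (TYB G)}
    (hinv : IsInvariantTY G χ τ I) {b : TYB G} (hb : b ∈ I) {r : BIdx G}
    (hr : lsupp r.1.1 ≠ rsupp r.1.1) : b r = 0 := by
  rw [← hinv] at hb
  induction hb using Submodule.span_induction with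
  | mem b hb => obtain ⟨a, -, x, rfl⟩ := hb; exact adTY_apply_eq_zero χ τ a x hr
  | zero => rfl
  | add a b _ _ ha hb => simp [ha, hb]
  | smul c b _ hb => simp [hb]

theorem adTY_mem_s15 {χ : G → G → ℂ} {τ : ℝ} {I : Submodule ℂ (TYB G)}
    (hinv : IsInvariantTY G χ τ I) {a : TYB G} (ha : a ∈ I) (x : TYB G) :
    adTY G χ τ a x ∈ I := by
  have h : adTY G χ τ a x ∈
      Submodule.span ℂ {y : TYB G | ∃ a ∈ I, ∃ x : TYB G, y = adTY G χ τ a x} :=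
    Submodule.subset_span ⟨a, ha, x, rfl⟩
  rwa [hinv] at h

theorem colTY_smul (c : ℂ) (u : TYV G) (j : VIdx G) : colTY (c • u) j = c • colTY u j := by
  ext p
  simp [colTY]

theorem colTY_zero (j : VIdx G) : colTY (0 : TYV G) j = 0 := by
  ext p
  simp [colTY]

theorem vecZero_zero_one : vecZero (0 : G → ℂ) 1 = Pi.single (Sum.inl (0, Sum.inr ())) 1 := by
  ext i
  rcases i with ⟨g, a | a⟩ | i <;> simp [vecZero, Pi.single_apply]

theorem colTY_vecZero_mem_ILTY {χ : G → G → ℂ} (hχ : ∀ h, χ 0 h = 1) {L : AddSubgroup G}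
    {φ : G → ℂ} (hφ : ∀ x, ∀ y, x - y ∈ L → φ x = φ y) (c : ℂ) (w : ΩIdx G) :
    colTY (vecZero φ c) (Sum.inl (0, w)) ∈ ILTY G χ L := by
  have key : colTY (vecZero φ c) (Sum.inl (0, w)) = c • bM G 0 w +
      (Fintype.card L : ℂ)⁻¹ • ∑ k, φ k • bCoset G {x : G | x - k ∈ L} w := by
    ext ⟨⟨i, j⟩, h⟩
    rw [bM_eq_colTY, ← vecZero_zero_one]
    simp_rw [bCoset_eq_colTY]
    by_cases hj : j = Sum.inl (0, w)
    · subst hj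
      simp only [colTY, Pi.add_apply, Pi.smul_apply, Finset.sum_apply, if_true, smul_eq_mul]
      rcases i with ⟨g, x | x⟩ | i
      · obtain rfl : g = 0 := by simpa [tyGrade] using h
        have hcard : ∑ k, (if x - k ∈ L then (1 : ℂ) else 0) = Fintype.card L := by
          rw [Finset.sum_boole, Fintype.card_subtype]
          congr 1
          refine Finset.card_bij' (fun k _ => x - k) (fun l _ => x - l) ?_ ?_ ?_ ?_ <;> simp
        have hsum : ∑ k, φ k * (if x - k ∈ L then (1 : ℂ) else 0) = φ x * Fintype.card L := by
          rw [← hcard, Finset.mul_sum]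
          refine Finset.sum_congr rfl fun k _ => ?_
          split_ifs with hk
          · rw [hφ x k hk]
          · simp
        simp only [vecZero, if_true, Pi.zero_apply, mul_zero, zero_add, Set.indicator_apply,
          Set.mem_ofPred_eq, Pi.one_apply, hsum]
        have : (Fintype.card L : ℂ) ≠ 0 := by exact_mod_cast Fintype.card_ne_zero
        field_simp
      · obtain rfl : g = 0 := by simpa [tyGrade] using h
        simp [vecZero]
      · simp [tyGrade] at h
    · simp [colTY, hj]
  rw [key]
  refine Submodule.add_mem _ (Submodule.smul_mem _ _ (Submodule.subset_span
    (Or.inr ⟨0, fun l _ => hχ l, w, rfl⟩))) (Submodule.smul_mem _ _ (Submodule.sum_mem _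
    fun k _ => Submodule.smul_mem _ _ (Submodule.subset_span (Or.inl ⟨k, w, rfl⟩))))

theorem eq_BsTY_or_exists_eq_ILTY {χ : G → G → ℂ} {τ : ℝ} (hτ : τ ≠ 0)
    (hsymm : ∀ g h, χ g h = χ h g) (hadd : ∀ g g' h, χ (g + g') h = χ g h * χ g' h)
    (hne : ∀ g h, χ g h ≠ 0) (hnondeg : ∀ g : G, (∀ h : G, χ g h = 1) → g = 0)
    {I : Submodule ℂ (TYB G)} (hco : IsCoidealTY G χ τ I) (hinv : IsInvariantTY G χ τ I)
    {X : ΩIdx G → Submodule ℂ (TYV G)}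
    (hsupp : ∀ y : ΩIdx G, ∀ u ∈ X y, ∀ i : VIdx G, tyGrade G i ≠ y → u i = 0)
    (hI : I = Submodule.span ℂ
      {b : TYB G | ∃ y : ΩIdx G, ∃ u ∈ X y, ∃ j : VIdx G, tyGrade G j = y ∧ b = colTY u j}) :
    I = BsTY G χ τ ∨ ∃ L : AddSubgroup G, I = ILTY G χ L := by
  have hχ : ∀ h, χ 0 h = 1 := bichar_zero_left hadd hne
  have hχ' : ∀ h, χ h 0 = 1 := fun h => by rw [hsymm, hχ]
  have hdiag : ∀ y, ∀ u ∈ X y, ∀ i, lsupp i ≠ rsupp i → u i = 0 := by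
    intro y u hu i hi
    by_cases hy : tyGrade G i = y
    · subst hy
      have := apply_eq_zero_of_isInvariantTY hinv (colTY_mem hI hu) (r := ⟨(i, i), rfl⟩) hi
      simpa [colTY] using this
    · exact hsupp y u hu i hy
  have hzero : ∀ u ∈ X (Sum.inl 0),
      u = vecZero (fun k => u (Sum.inl (0, Sum.inl k))) (u (Sum.inl (0, Sum.inr ()))) := by
    intro u hu
    ext i
    rcases i with ⟨g, a | a⟩ | i
    · by_cases hg : g = 0
      · subst hg; simp [vecZero]
      · simpa [vecZero, hg]
          using hsupp _ u hu (Sum.inl (g, Sum.inl a)) (by simpa [tyGrade] using hg)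
    · by_cases hg : g = 0
      · subst hg; simp [vecZero]
      · simpa [vecZero, hg]
          using hsupp _ u hu (Sum.inl (g, Sum.inr a)) (by simpa [tyGrade] using hg)
    · simpa [vecZero] using hsupp _ u hu (Sum.inr i) (by simp [tyGrade])
  have hnonzero : ∀ g ≠ 0, ∀ u ∈ X (Sum.inl g),
      u = u (Sum.inl (g, Sum.inr ())) • Pi.single (Sum.inl (g, Sum.inr ())) 1 := by
    intro g hg u hu
    ext i
    by_cases hi : i = Sum.inl (g, Sum.inr ())
    · subst hi; simp
    · rw [Pi.smul_apply, Pi.single_eq_of_ne hi, smul_zero]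
      by_cases hgr : tyGrade G i = Sum.inl g
      · rcases i with ⟨g', a | a⟩ | i
        · obtain rfl : g' = g := by simpa [tyGrade] using hgr
          exact hdiag _ u hu _ (by simpa [lsupp, rsupp, shiftΩ] using hg)
        · obtain rfl : g' = g := by simpa [tyGrade] using hgr
          exact absurd rfl hi
        · simp [tyGrade] at hgr
      · exact hsupp _ u hu i hgr
  have hM : ∀ u ∈ X (Sum.inr ()), u = 0 := by
    intro u hu
    ext i
    rcases i with ⟨g, a⟩ | i | i
    · exact hsupp _ u hu _ (by simp [tyGrade])
    · exact hdiag _ u hu _ (by simp [lsupp, rsupp])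
    · exact hdiag _ u hu _ (by simp [lsupp, rsupp])
  have hunit : vecZero 1 1 ∈ X (Sum.inl 0) := by
    convert colMap_mem hsupp hI hco.1 (j := Sum.inl (0, Sum.inr ()))
      (y := Sum.inl 0) rfl using 1
    ext i
    by_cases hi : tyGrade G i = tyGrade G (Sum.inl ((0 : G), Sum.inr ()))
    · rw [colMap_apply_of_grade hi, vecZero_one_apply, oneTY_apply]
    · rw [colMap_apply_of_ne hi, vecZero_one_apply]
      exact if_neg hi
  let S : Set G := {g | Pi.single (Sum.inl (g, Sum.inr ())) 1 ∈ X (Sum.inl g)}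
  have hS : ∀ g ∈ S, Pi.single (idxG g (Sum.inr ()) (Sum.inr ())) 1 ∈ I := by
    intro g hg
    have := colTY_mem hI (j := Sum.inl (g, Sum.inr ())) hg
    rwa [colTY_single _ _ rfl] at this
  have hSadd : ∀ g ∈ S, ∀ h ∈ S, g + h ∈ S := by
    intro g hg h hh
    have hmul := hco.2.1 _ (hS g hg) _ (hS h hh)
    rw [mulTY_idxG_idxG] at hmul
    have := colMap_mem hsupp hI hmul (j := Sum.inl (g + h, Sum.inr ()))
      (y := Sum.inl (g + h)) rfl
    change Pi.single _ _ ∈ X _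
    convert this using 1
    ext i
    by_cases hi : tyGrade G i = tyGrade G (Sum.inl (g + h, Sum.inr ()))
    · rw [colMap_apply_of_grade hi]
      simp only [Pi.single_apply, idxG, Subtype.ext_iff, Prod.mk.injEq, and_true]
    · rw [colMap_apply_of_ne hi, Pi.single_eq_of_ne]
      rintro rfl
      exact hi rfl
  have hchar : ∀ g ∈ S, vecZero (χ g) 0 ∈ X (Sum.inl 0) := by
    intro g hg
    have had := adTY_mem_s15 hinv (hS g hg) (Pi.single (idxM (Sum.inr 0) (Sum.inr 0)) 1)
    have := colMap_mem hsupp hI had (j := Sum.inl (0, Sum.inl 0))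
      (y := Sum.inl 0) rfl
    convert this using 1
    rw [hzero _ this]
    congr 1
    · ext k
      exact ((colMap_apply_of_grade (i := Sum.inl (0, Sum.inl k))
        (j := Sum.inl (0, Sum.inl 0)) rfl _).trans (adTY_idxG_apply hχ' τ g (Sum.inl k))).symm
    · exact ((colMap_apply_of_grade (i := Sum.inl (0, Sum.inr ()))
        (j := Sum.inl (0, Sum.inl 0)) rfl _).trans (adTY_idxG_apply hχ' τ g (Sum.inr ()))).symm
  have hfour : ∀ g ≠ 0, ∀ u ∈ X (Sum.inl 0),
      ∑ k, u (Sum.inl (0, Sum.inl k)) * (χ g k)⁻¹ ≠ 0 → g ∈ S := by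
    intro g hg u hu hsum
    have had := adTY_mem_s15 hinv (colTY_mem hI (j := Sum.inl (0, Sum.inl 0)) hu)
      (Pi.single (idxM (Sum.inl 0) (Sum.inl 0)) 1)
    have hmem := colMap_mem hsupp hI had (j := Sum.inl (g, Sum.inr ()))
      (y := Sum.inl g) rfl
    have hval := adTY_colTY_apply hχ hχ' τ u g
    rw [hnonzero g hg _ hmem] at hmem
    refine (Submodule.smul_mem_iff _ ?_).1 hmem
    rw [colMap_apply_of_grade rfl]
    refine (hval.trans_ne ?_)
    exact mul_ne_zero (pow_ne_zero _ (by exact_mod_cast hτ)) hsum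
  by_cases hSne : S.Nonempty
  · right
    obtain ⟨K, hK⟩ := exists_addSubgroup_of_add_mem hSne hSadd
    have hKS : ∀ g, g ∈ K ↔ g ∈ S := fun g => by rw [← hK]; rfl
    have hfour' : ∀ g, ∀ u ∈ X (Sum.inl 0),
        ∑ k, u (Sum.inl (0, Sum.inl k)) * (χ g k)⁻¹ ≠ 0 → g ∈ K := by
      intro g u hu h
      by_cases hg : g = 0
      · rw [hg]; exact K.zero_mem
      · exact (hKS g).2 (hfour g hg u hu h)
    let L : AddSubgroup G :=
      { carrier := {l | ∀ s ∈ K, χ s l = 1}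
        add_mem' := fun {a b} ha hb s hs => by rw [hsymm, hadd, hsymm a, hsymm b, ha s hs, hb s hs,
          one_mul]
        zero_mem' := fun s _ => hχ' s
        neg_mem' := fun {a} ha s hs => by
          rw [hsymm, bichar_neg_left hadd hne, hsymm, ha s hs, inv_one] }
    have hcoset : ∀ g, vecZero ({x : G | x - g ∈ L}.indicator 1) 0 ∈ X (Sum.inl 0) := by
      intro g
      have key : vecZero ({x : G | x - g ∈ L}.indicator 1) 0 =
          (Fintype.card K : ℂ)⁻¹ • ∑ s : K, χ s (-g) • vecZero (χ s) 0 := by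
        ext i
        rw [Pi.smul_apply, Finset.sum_apply]
        rcases i with ⟨g', x | x⟩ | i
        · have h := sum_addSubgroup_bichar hadd K (x - g)
          have h' : ∑ s : K, χ s (-g) * χ s x = ∑ s : K, χ s (x - g) :=
            Finset.sum_congr rfl fun s _ => by
              rw [hsymm _ (x - g), sub_eq_add_neg, hadd, hsymm x, hsymm (-g), mul_comm]
          by_cases hg' : g' = 0
          · have hc : (Fintype.card K : ℂ) ≠ 0 := by exact_mod_cast Fintype.card_ne_zero
            have hmem : x - g ∈ L ↔ ∀ s ∈ K, χ s (x - g) = 1 := Iff.rfl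
            simp only [vecZero, hg', if_true, Pi.smul_apply, smul_eq_mul, h', h,
              Set.indicator_apply, Set.mem_ofPred_eq, hmem]
            split_ifs <;> simp [hc]
          · simp [vecZero, hg']
        · simp [vecZero]
        · simp [vecZero]
      rw [key]
      exact Submodule.smul_mem _ _ (Submodule.sum_mem _ fun s _ =>
        Submodule.smul_mem _ _ (hchar s ((hKS s).1 s.2)))
    have hperp : ∀ l, l ∈ Lperp G χ L ↔ l ∈ K := by
      intro l
      constructor
      · intro hl
        refine hfour' l _ (hcoset 0) ?_
        have : ∀ k, vecZero ({x : G | x - 0 ∈ L}.indicator 1) 0 (Sum.inl (0, Sum.inl k)) *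
            (χ l k)⁻¹ = if k ∈ L then (1 : ℂ) else 0 := by
          intro k
          simp only [vecZero, if_true, sub_zero, Set.indicator_apply, Set.mem_ofPred_eq,
            Pi.one_apply]
          split_ifs with hk
          · rw [hl k hk, inv_one, one_mul]
          · rw [zero_mul]
        simp_rw [this]
        rw [Finset.sum_boole, Nat.cast_ne_zero, Finset.card_ne_zero]
        exact ⟨0, by simp⟩
      · exact fun hl k hk => hk l hl
    refine ⟨L, le_antisymm ?_ ?_⟩
    · rw [hI, Submodule.span_le]
      rintro _ ⟨_, u, hu, j, rfl, rfl⟩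
      rcases j with ⟨g, w⟩ | j
      · by_cases hg : g = 0
        · subst hg
          rw [hzero u hu]
          refine colTY_vecZero_mem_ILTY hχ ?_ _ w
          intro x y hxy
          have hc : (Fintype.card G : ℂ) ≠ 0 := by exact_mod_cast Fintype.card_ne_zero
          refine mul_left_cancel₀ hc ?_
          have hinv := fourier_inversion hsymm hadd hne hnondeg
            (fun k => u (Sum.inl (0, Sum.inl k)))
          rw [← hinv x, ← hinv y]
          refine Finset.sum_congr rfl fun g _ => ?_
          by_cases hs : ∑ k, u (Sum.inl (0, Sum.inl k)) * (χ g k)⁻¹ = 0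
          · rw [hs, zero_mul, zero_mul]
          · have h1 : χ g (x - y) = 1 := hxy g (hfour' g u hu hs)
            rw [← sub_add_cancel x y, hsymm g (x - y + y), hadd, hsymm (x - y), h1, one_mul,
              hsymm y]
        · have hu' : u ∈ X (Sum.inl g) := hu
          rw [hnonzero g hg u hu', colTY_smul, ← bM_eq_colTY]
          by_cases hc : u (Sum.inl (g, Sum.inr ())) = 0
          · simp [hc]
          · refine Submodule.smul_mem _ _ (Submodule.subset_span (Or.inr ⟨g, ?_, w, rfl⟩))
            rw [hperp, hKS]
            rw [hnonzero g hg u hu'] at hu'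
            exact (Submodule.smul_mem_iff _ hc).1 hu'
      · rw [hM u hu, colTY_zero]
        exact Submodule.zero_mem _
    · rw [ILTY, Submodule.span_le]
      rintro _ (⟨g, w, rfl⟩ | ⟨l, hl, w, rfl⟩)
      · rw [bCoset_eq_colTY]
        exact colTY_mem hI (hcoset g)
      · rw [bM_eq_colTY]
        exact colTY_mem hI ((hKS l).1 ((hperp l).1 hl))
  · left
    have hnot : ∀ g, g ∉ S := fun g hg => hSne ⟨g, hg⟩
    have hconst : ∀ u ∈ X (Sum.inl 0), u = u (Sum.inl (0, Sum.inl 0)) • vecZero 1 1 := by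
      intro u hu
      have hconst : ∀ x, u (Sum.inl (0, Sum.inl x)) = u (Sum.inl (0, Sum.inl 0)) := by
        intro x
        have hc : (Fintype.card G : ℂ) ≠ 0 := by exact_mod_cast Fintype.card_ne_zero
        refine mul_left_cancel₀ hc ?_
        have hinv := fourier_inversion hsymm hadd hne hnondeg
          (fun k => u (Sum.inl (0, Sum.inl k)))
        rw [← hinv x, ← hinv 0]
        refine Finset.sum_congr rfl fun g _ => ?_
        by_cases hg : g = 0
        · rw [hg, hχ, hχ]
        · rw [not_not.1 fun h => hnot g (hfour g hg u hu h), zero_mul, zero_mul]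
      have hm : u (Sum.inl (0, Sum.inr ())) = u (Sum.inl (0, Sum.inl 0)) := by
        by_contra hne'
        refine hnot 0 ?_
        change Pi.single _ _ ∈ X _
        rw [← vecZero_zero_one]
        refine (Submodule.smul_mem_iff _ (sub_ne_zero.2 hne')).1 ?_
        convert Submodule.sub_mem _ hu (Submodule.smul_mem _ (u (Sum.inl (0, Sum.inl 0))) hunit)
          using 1
        rw [hzero u hu]
        ext i
        rcases i with ⟨g, a | a⟩ | i <;> simp [vecZero, hconst]
        by_cases hg : g = 0 <;> simp [hg]
      conv_lhs => rw [hzero u hu]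
      ext i
      rcases i with ⟨g, a | a⟩ | i <;> simp [vecZero, hconst, hm]
    rw [BsTY_eq_span]
    apply le_antisymm
    · rw [hI, Submodule.span_le]
      rintro _ ⟨_, u, hu, j, rfl, rfl⟩
      rcases j with ⟨g, w⟩ | j
      · by_cases hg : g = 0
        · subst hg
          rw [hconst u hu, colTY_smul]
          exact Submodule.smul_mem _ _ (Submodule.subset_span ⟨w, rfl⟩)
        · have hu' : u ∈ X (Sum.inl g) := hu
          rw [hnonzero g hg u hu'] at hu'
          have hc : u (Sum.inl (g, Sum.inr ())) = 0 := by
            by_contra hc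
            exact hnot g ((Submodule.smul_mem_iff _ hc).1 hu')
          rw [hnonzero g hg u hu, hc, zero_smul, colTY_zero]
          exact Submodule.zero_mem _
      · rw [hM u hu, colTY_zero]
        exact Submodule.zero_mem _
    · rw [Submodule.span_le]
      rintro _ ⟨w, rfl⟩
      exact colTY_mem hI hunit

end Helpers

/-- every invariant coideal of the Tambara–Yamagami WHA of the graded form
`⊕_{y ∈ Ω} X^y ⊗ conj(H^y)` equals `I^x` for exactly one `x ∈ Subgrp(G) ⊔ {Ω}`. -/
theorem TY_invariant_coideal_classification (G : Type) [AddCommGroup G] [Fintype G]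
    [DecidableEq G] (χ : G → G → ℂ) (τ : ℝ)
    (hχsymm : ∀ g h : G, χ g h = χ h g)
    (hχadd : ∀ g g' h : G, χ (g + g') h = χ g h * χ g' h)
    (hχnorm : ∀ g h : G, ‖χ g h‖ = 1)
    (hχnondeg : ∀ g : G, (∀ h : G, χ g h = 1) → g = 0)
    (hτ : τ = (Real.sqrt (Fintype.card G))⁻¹ ∨ τ = -(Real.sqrt (Fintype.card G))⁻¹)
    (I : Submodule ℂ (TYB G))
    (hco : IsCoidealTY G χ τ I) (hinv : IsInvariantTY G χ τ I)
    -- `I` is of the form `⊕_{y ∈ Ω} X^y ⊗ conj(H^y)`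
    (hform : ∃ X : ΩIdx G → Submodule ℂ (TYV G),
      (∀ y : ΩIdx G, ∀ u ∈ X y, ∀ i : VIdx G, tyGrade G i ≠ y → u i = 0) ∧
      I = Submodule.span ℂ
        {b : TYB G | ∃ y : ΩIdx G, ∃ u ∈ X y, ∃ j : VIdx G, tyGrade G j = y ∧
          b = fun p : BIdx G => if p.1.2 = j then u p.1.1 else 0}) :
    ∃! x : AddSubgroup G ⊕ Unit,
      I = (match x with
        | Sum.inl L => ILTY G χ L
        | Sum.inr _ => BsTY G χ τ) := by
  have hne : ∀ g h, χ g h ≠ 0 := fun g h h0 => by simpa [h0] using hχnorm g h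
  have hτ0 : τ ≠ 0 := by
    have hpos : (0 : ℝ) < (Real.sqrt (Fintype.card G))⁻¹ :=
      inv_pos.2 (Real.sqrt_pos.2 (by exact_mod_cast Fintype.card_pos))
    rcases hτ with rfl | rfl
    · exact hpos.ne'
    · exact neg_ne_zero.2 hpos.ne'
  have hχ := bichar_zero_left hχadd hne
  obtain ⟨X, hsupp, hI⟩ := hform
  rcases eq_BsTY_or_exists_eq_ILTY hτ0 hχsymm hχadd hne hχnondeg hco hinv hsupp hI with
    h | ⟨L, h⟩
  · refine ⟨Sum.inr (), h, ?_⟩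
    rintro (L' | u) h'
    · exact absurd (h'.symm.trans h) (ILTY_ne_BsTY hχ τ L')
    · rfl
  · refine ⟨Sum.inl L, h, ?_⟩
    rintro (L' | u) h'
    · exact congrArg Sum.inl (ILTY_injective χ (h'.symm.trans h))
    · exact absurd (h.symm.trans h') (ILTY_ne_BsTY hχ τ L)

end
end
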